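/- For each N ≥ 1, let X_N = U_N D_N U_N^* be an N×N Hermitian random matrix, where U_N is Haar-distributed on the unitary group U(N) and D_N is a random real diagonal matrix independent of U_N. Let λ_1^{(N)} ≤ ⋯ ≤ λ_N^{(N)} be the eigenvalues of X_N, let m_N = (1/N) Σ_{i=1}^N δ_{λ_i^{(N)}} be the empirical eigenvalue distribution, and let λ̃_1^{(N)} ≤ ⋯ ≤ λ̃_{N−1}^{(N)} be the eigenvalues of the principal submatrix X̃_N obtained by deleting the last row and column of X_N. Set M_k(κ_N) = Σ_{i=1}^N (λ_i^{(N)})^k − Σ_{j=1}^{N−1} (λ̃_j^{(N)})^k and M_k(τ_N) = Σ_{ρ ∈ NC(k)} (k + 1 − |ρ|) fc_ρ(m_N). Assume that sup_{N≥1} E[M_k(m_N)] < ∞ for every even k. Then for every k ≥ 1, E[M_k(κ_N)] = E[M_k(τ_N)] + O(1/N) as N → ∞, i.e., there is a constant C (depending on k) with |E[M_k(κ_N)] − E[M_k(τ_N)]| ≤ C/N for all N. -/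

import Mathlib

open MeasureTheory ProbabilityTheory Finset
open scoped Classical

/-- Measurable structure on matrices (entrywise, i.e. the product σ-algebra). -/
instance matrixMeasurableSpace {m n α : Type*} [MeasurableSpace α] :
    MeasurableSpace (Matrix m n α) :=
  inferInstanceAs (MeasurableSpace (m → n → α))

/-- `ρ` is a partition of the finite set `S ⊆ ℕ`: its blocks are nonempty subsets of `S`
and every element of `S` lies in exactly one block. -/
def IsPartitionOn (S : Finset ℕ) (ρ : Finset (Finset ℕ)) : Prop :=
  (∀ B ∈ ρ, B.Nonempty) ∧ (∀ B ∈ ρ, B ⊆ S) ∧ (∀ x ∈ S, ∃! B, B ∈ ρ ∧ x ∈ B)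

/-- A family of blocks is non-crossing if no two distinct blocks cross. -/
def IsNoncrossing (ρ : Finset (Finset ℕ)) : Prop :=
  ∀ B ∈ ρ, ∀ C ∈ ρ, B ≠ C →
    ¬ ∃ a b c d : ℕ, a ∈ B ∧ b ∈ B ∧ c ∈ C ∧ d ∈ C ∧ a < c ∧ c < b ∧ b < d

/-- `ρ` is a non-crossing partition of `S`. -/
def IsNCPartitionOn (S : Finset ℕ) (ρ : Finset (Finset ℕ)) : Prop :=
  IsPartitionOn S ρ ∧ IsNoncrossing ρ

/-- `NC(k)`: the finite set of all non-crossing partitions of `{1, …, k}`. -/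
noncomputable def NCFinset (k : ℕ) : Finset (Finset (Finset ℕ)) :=
  ((Finset.Icc 1 k).powerset.powerset).filter (IsNCPartitionOn (Finset.Icc 1 k))

instance Matrix.borelSpace_complex {m n : Type*} [Countable m] [Countable n] :
    BorelSpace (Matrix m n ℂ) :=
  inferInstanceAs (BorelSpace (m → n → ℂ))

instance Matrix.unitaryGroup.compactSpace {m : Type*} [Fintype m] [DecidableEq m] :
    CompactSpace (Matrix.unitaryGroup m ℂ) := by
  refine (isCompact_iff_compactSpace (s := (Matrix.unitaryGroup m ℂ : Set (Matrix m m ℂ)))).1 ?_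
  have hc : IsClosed (Matrix.unitaryGroup m ℂ : Set (Matrix m m ℂ)) := isClosed_unitary
  have hK : IsCompact (Set.pi Set.univ fun _ : m => Set.pi Set.univ fun _ : m =>
      Metric.closedBall (0 : ℂ) 1) :=
    isCompact_univ_pi fun _ => isCompact_univ_pi fun _ => isCompact_closedBall _ _
  refine hK.of_isClosed_subset hc fun V hV => ?_
  simp only [Set.mem_pi, Set.mem_univ, true_implies, mem_closedBall_zero_iff]
  exact fun i j => entry_norm_bound_of_unitary hV i j

/-- A Haar distributed random unitary matrix is invariant in law under right multiplication. -/
theorem integral_haar_unitary_mul_right {Ω m : Type*} [MeasurableSpace Ω] [Fintype m]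
    [DecidableEq m] {P : Measure Ω} [IsProbabilityMeasure P] {U : Ω → Matrix m m ℂ}
    (hU : Measurable U) (hUu : ∀ ω, U ω ∈ Matrix.unitaryGroup m ℂ)
    (hH : (Measure.map (fun ω => (⟨U ω, hUu ω⟩ : Matrix.unitaryGroup m ℂ)) P).IsHaarMeasure)
    (V : Matrix.unitaryGroup m ℂ) {f : Matrix m m ℂ → ℝ} (hf : Measurable f) :
    ∫ ω, f (U ω * (V : Matrix m m ℂ)) ∂P = ∫ ω, f (U ω) ∂P := by
  have hm : Measurable fun ω => (⟨U ω, hUu ω⟩ : Matrix.unitaryGroup m ℂ) := hU.subtype_mk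
  have : SecondCountableTopology (Matrix m m ℂ) :=
    inferInstanceAs (SecondCountableTopology (m → m → ℂ))
  have : TopologicalSpace.PseudoMetrizableSpace (Matrix m m ℂ) :=
    inferInstanceAs (TopologicalSpace.PseudoMetrizableSpace (m → m → ℂ))
  have := hH
  have : BorelSpace (Matrix.unitaryGroup m ℂ) := Subtype.borelSpace _
  set μ := Measure.map (fun ω => (⟨U ω, hUu ω⟩ : Matrix.unitaryGroup m ℂ)) P with hμ
  have : TopologicalSpace.PseudoMetrizableSpace (Matrix.unitaryGroup m ℂ) :=
    Topology.IsInducing.subtypeVal.pseudoMetrizableSpace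
  have : IsProbabilityMeasure μ := Measure.isProbabilityMeasure_map hm.aemeasurable
  have : IsProbabilityMeasure (μ.map (· * V)) :=
    Measure.isProbabilityMeasure_map (measurable_mul_const V).aemeasurable
  have hV : μ.map (· * V) = μ := Measure.isHaarMeasure_eq_of_isProbabilityMeasure _ _
  have hfm : Measurable fun g : Matrix.unitaryGroup m ℂ => f (g : Matrix m m ℂ) :=
    hf.comp measurable_subtype_coe
  calc ∫ ω, f (U ω * (V : Matrix m m ℂ)) ∂P
      = ∫ g, f ((g * V : Matrix.unitaryGroup m ℂ) : Matrix m m ℂ) ∂μ :=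
        (integral_map hm.aemeasurable
          (hfm.comp (measurable_mul_const V)).aestronglyMeasurable).symm
    _ = ∫ g, f (g : Matrix m m ℂ) ∂(μ.map (· * V)) :=
        (integral_map (measurable_mul_const V).aemeasurable hfm.aestronglyMeasurable).symm
    _ = ∫ ω, f (U ω) ∂P := by
        rw [hV]
        exact integral_map hm.aemeasurable hfm.aestronglyMeasurable

theorem sum_exp_sign_le {m : Type*} [Fintype m] [DecidableEq m] (x : m → ℝ)
    (hx : ∑ i, x i ^ 2 ≤ 1) :
    ∑ e : m → Bool, Real.exp (∑ i, (if e i then 1 else -1) * x i)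
      ≤ 2 ^ Fintype.card m * Real.exp (1 / 2) := by
  have h1 : ∑ e : m → Bool, Real.exp (∑ i, (if e i then 1 else -1) * x i)
      = ∏ i, (2 * Real.cosh (x i)) := by
    have h2 : ∀ i, 2 * Real.cosh (x i)
        = ∑ b : Bool, Real.exp ((if b then 1 else -1) * x i) := fun i => by
      simp [Real.cosh_eq]; ring
    simp_rw [h2, Finset.prod_univ_sum, Fintype.piFinset_univ, Real.exp_sum]
  rw [h1, Finset.prod_mul_distrib, Finset.prod_const, Finset.card_univ]
  gcongr
  calc ∏ i, Real.cosh (x i) ≤ ∏ i, Real.exp (x i ^ 2 / 2) :=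
        Finset.prod_le_prod (fun i _ => (Real.cosh_pos _).le)
          fun i _ => Real.cosh_le_exp_half_sq _
    _ = Real.exp ((∑ i, x i ^ 2) / 2) := by rw [← Real.exp_sum, Finset.sum_div]
    _ ≤ Real.exp (1 / 2) := by gcongr

/-- Khintchine's inequality for even moments of real Rademacher sums. -/
theorem sum_sign_pow_le {m : Type*} [Fintype m] [DecidableEq m] (r : ℕ) (x : m → ℝ)
    (hx : ∑ i, x i ^ 2 ≤ 1) :
    ∑ e : m → Bool, (∑ i, (if e i then 1 else -1) * x i) ^ (2 * r)
      ≤ 2 ^ Fintype.card m * (2 * (2 * r).factorial * Real.exp (1 / 2)) := by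
  have hy : ∀ y : ℝ, y ^ (2 * r) ≤ (2 * r).factorial * (Real.exp y + Real.exp (-y)) := fun y => by
    have h1 := Real.pow_div_factorial_le_exp |y| (abs_nonneg y) (2 * r)
    rw [div_le_iff₀ (by positivity), (even_two_mul r).pow_abs] at h1
    have h2 : Real.exp |y| ≤ Real.exp y + Real.exp (-y) := by
      rcases abs_choice y with h | h <;> rw [h] <;> linarith [Real.exp_pos y, Real.exp_pos (-y)]
    nlinarith [(by positivity : (0 : ℝ) < (2 * r).factorial)]
  have h1 := sum_exp_sign_le x hx
  have h2 := sum_exp_sign_le (fun i => -x i) (by simpa using hx)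
  calc ∑ e : m → Bool, (∑ i, (if e i then 1 else -1) * x i) ^ (2 * r)
      ≤ ∑ e : m → Bool, ((2 * r).factorial : ℝ) *
          (Real.exp (∑ i, (if e i then 1 else -1) * x i)
            + Real.exp (∑ i, (if e i then 1 else -1) * -x i)) := by
        refine Finset.sum_le_sum fun e _ => (hy _).trans_eq ?_
        simp [Finset.sum_neg_distrib]
    _ ≤ _ := by
        rw [← Finset.mul_sum, Finset.sum_add_distrib]
        nlinarith [(by positivity : (0 : ℝ) < (2 * r).factorial)]

/-- Khintchine's inequality for even moments of complex Rademacher sums. -/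
theorem sum_sign_norm_pow_le {m : Type*} [Fintype m] [DecidableEq m] (r : ℕ) (u : m → ℂ)
    (hu : ∑ i, ‖u i‖ ^ 2 = 1) :
    ∑ e : m → Bool, ‖∑ i, u i * (if e i then 1 else -1)‖ ^ (2 * r)
      ≤ 2 ^ Fintype.card m * (2 ^ r * (4 * (2 * r).factorial * Real.exp (1 / 2))) := by
  have hsq : ∀ z : ℂ, ‖z‖ ^ 2 = z.re ^ 2 + z.im ^ 2 := fun z => by
    rw [Complex.sq_norm, Complex.normSq_apply]; ring
  simp_rw [hsq, Finset.sum_add_distrib] at hu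
  have hre := sum_sign_pow_le r (fun i => (u i).re)
    (by linarith [Finset.sum_nonneg fun i (_ : i ∈ univ) => sq_nonneg (u i).im])
  have him := sum_sign_pow_le r (fun i => (u i).im)
    (by linarith [Finset.sum_nonneg fun i (_ : i ∈ univ) => sq_nonneg (u i).re])
  have hz : ∀ z : ℂ, ‖z‖ ^ (2 * r) ≤ 2 ^ r * (z.re ^ (2 * r) + z.im ^ (2 * r)) := fun z => by
    rw [pow_mul, hsq, pow_mul, pow_mul]
    refine (add_pow_le (sq_nonneg _) (sq_nonneg _) r).trans ?_
    gcongr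
    · norm_num
    · omega
  calc ∑ e : m → Bool, ‖∑ i, u i * (if e i then 1 else -1)‖ ^ (2 * r)
      ≤ ∑ e : m → Bool, (2 : ℝ) ^ r * ((∑ i, (if e i then 1 else -1) * (u i).re) ^ (2 * r)
          + (∑ i, (if e i then 1 else -1) * (u i).im) ^ (2 * r)) := by
        refine Finset.sum_le_sum fun e _ => (hz _).trans_eq ?_
        simp only [Complex.re_sum, Complex.im_sum]
        congr! 6 <;> split_ifs <;> simp
    _ ≤ _ := by
        rw [← Finset.mul_sum, Finset.sum_add_distrib]
        nlinarith [(by positivity : (0 : ℝ) < 2 ^ r)]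

/-- Every unit vector is a prescribed column of some unitary matrix. -/
theorem exists_unitary_col {m : Type*} [Fintype m] [DecidableEq m] (c : m) (v : m → ℂ)
    (hv : ∑ i, ‖v i‖ ^ 2 = 1) :
    ∃ V : Matrix.unitaryGroup m ℂ, ∀ k, (V : Matrix m m ℂ) k c = v k := by
  have hnorm : ‖WithLp.toLp 2 v‖ = 1 := by
    rw [EuclideanSpace.norm_eq]; simp [hv]
  have ho : Orthonormal ℂ (({c} : Set m).domRestrict fun _ : m => WithLp.toLp 2 v) := by
    constructor
    · intro i; exact hnorm
    · intro i j hij; exact absurd (Subsingleton.elim i j) hij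
  obtain ⟨b, hb⟩ := ho.exists_orthonormalBasis_extension_of_card_eq (by simp)
  refine ⟨⟨(EuclideanSpace.basisFun m ℂ).toBasis.toMatrix b,
    (EuclideanSpace.basisFun m ℂ).toMatrix_orthonormalBasis_mem_unitary b⟩, fun k => ?_⟩
  simp [Module.Basis.toMatrix_apply, hb c rfl]

theorem sum_norm_sq_row_eq_one {m : Type*} [Fintype m] [DecidableEq m] {V : Matrix m m ℂ}
    (hV : V ∈ Matrix.unitaryGroup m ℂ) (i : m) : ∑ k, ‖V i k‖ ^ 2 = 1 := by
  have h := congrFun (congrFun (Matrix.mem_unitaryGroup_iff.1 hV) i) i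
  simp only [Matrix.mul_apply, Matrix.star_apply, Matrix.one_apply_eq, RCLike.star_def,
    Complex.mul_conj, Complex.normSq_eq_norm_sq] at h
  exact_mod_cast h

theorem integrable_prod_entries {Ω m ι : Type*} [MeasurableSpace Ω] [Fintype m] [DecidableEq m]
    [Fintype ι] {P : Measure Ω} [IsProbabilityMeasure P] {U : Ω → Matrix m m ℂ}
    (hU : Measurable U) (hUu : ∀ ω, U ω ∈ Matrix.unitaryGroup m ℂ) (i : m) (c : ι → m) :
    Integrable (fun ω => ∏ j, ‖U ω i (c j)‖ ^ 2) P := by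
  have hm : ∀ j, Measurable fun ω => U ω i (c j) := fun j =>
    (measurable_pi_apply (c j)).comp ((measurable_pi_apply i).comp hU)
  refine Integrable.of_bound (C := 1)
    (Finset.measurable_prod _ fun j _ => (hm j).norm.pow_const 2).aestronglyMeasurable
    (ae_of_all _ fun ω => ?_)
  rw [Real.norm_of_nonneg (by positivity)]
  exact Finset.prod_le_one (fun _ _ => by positivity) fun j _ =>
    pow_le_one₀ (norm_nonneg _) (entry_norm_bound_of_unitary (hUu ω) _ _)

/-- Moments of a single entry of a Haar unitary matrix are of order `N ^ (-r)`. -/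
theorem integral_entry_pow_le {Ω m : Type*} [MeasurableSpace Ω] [Fintype m]
    [DecidableEq m] {P : Measure Ω} [IsProbabilityMeasure P] {U : Ω → Matrix m m ℂ}
    (hU : Measurable U) (hUu : ∀ ω, U ω ∈ Matrix.unitaryGroup m ℂ)
    (hH : (Measure.map (fun ω => (⟨U ω, hUu ω⟩ : Matrix.unitaryGroup m ℂ)) P).IsHaarMeasure)
    (r : ℕ) (i c : m) :
    ∫ ω, (‖U ω i c‖ ^ 2) ^ r ∂P
      ≤ (2 ^ r * (4 * (2 * r).factorial * Real.exp (1 / 2))) / (Fintype.card m : ℝ) ^ r := by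
  set N : ℝ := (Fintype.card m : ℝ) with hN
  have hNpos : 0 < N := by rw [hN]; exact_mod_cast Fintype.card_pos_iff.2 ⟨i⟩
  have hV : ∀ e : m → Bool, ∃ V : Matrix.unitaryGroup m ℂ, ∀ k,
      (V : Matrix m m ℂ) k c = (if e k then 1 else -1) * ((Real.sqrt N)⁻¹ : ℝ) := fun e => by
    apply exists_unitary_col
    have : ∀ k, ‖((if e k then 1 else -1) * ((Real.sqrt N)⁻¹ : ℝ) : ℂ)‖ ^ 2 = N⁻¹ := fun k => by
      rw [norm_mul, Complex.norm_real, mul_pow]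
      split_ifs <;> simp [Real.sq_sqrt hNpos.le]
    simp_rw [this]
    simp [← hN, hNpos.ne']
  choose V hV using hV
  have hentry : ∀ e ω, (‖(U ω * (V e : Matrix m m ℂ)) i c‖ ^ 2) ^ r
      = ‖∑ k, U ω i k * (if e k then 1 else -1)‖ ^ (2 * r) / N ^ r := fun e ω => by
    have : (U ω * (V e : Matrix m m ℂ)) i c
        = (∑ k, U ω i k * (if e k then 1 else -1)) * ((Real.sqrt N)⁻¹ : ℝ) := by
      simp [Matrix.mul_apply, hV, Finset.sum_mul]
    rw [this, norm_mul, Complex.norm_real, mul_pow, mul_pow, ← pow_mul, div_eq_mul_inv]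
    congr 1
    simp [Real.sq_sqrt hNpos.le]
  have hm : ∀ k, Measurable fun ω => U ω i k := fun k =>
    (measurable_pi_apply k).comp ((measurable_pi_apply i).comp hU)
  have hfm : Measurable fun A : Matrix m m ℂ => (‖A i c‖ ^ 2) ^ r :=
    (((measurable_pi_apply c).comp (measurable_pi_apply i)).norm.pow_const 2).pow_const r
  have hinv : ∀ e : m → Bool, ∫ ω, ‖∑ k, U ω i k * (if e k then 1 else -1)‖ ^ (2 * r) / N ^ r ∂P
      = ∫ ω, (‖U ω i c‖ ^ 2) ^ r ∂P := fun e => by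
    rw [← integral_haar_unitary_mul_right hU hUu hH (V e) hfm]
    simp_rw [hentry]
  have hint : ∀ e : m → Bool,
      Integrable (fun ω => ‖∑ k, U ω i k * (if e k then 1 else -1)‖ ^ (2 * r) / N ^ r) P :=
    fun e => by
    refine Integrable.of_bound (C := 1) (Measurable.aestronglyMeasurable ?_)
      (ae_of_all _ fun ω => ?_)
    · exact ((Finset.measurable_sum _ fun k _ => (hm k).mul_const _).norm.pow_const _).div_const _
    · rw [← hentry, Real.norm_of_nonneg (by positivity)]
      refine pow_le_one₀ (by positivity) (pow_le_one₀ (norm_nonneg _)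
        (entry_norm_bound_of_unitary (Submonoid.mul_mem _ (hUu ω) (V e).2) _ _))
  have hsum : (2 : ℝ) ^ Fintype.card m * ∫ ω, (‖U ω i c‖ ^ 2) ^ r ∂P
      = ∫ ω, ∑ e : m → Bool, ‖∑ k, U ω i k * (if e k then 1 else -1)‖ ^ (2 * r) / N ^ r ∂P := by
    rw [integral_finsetSum _ fun e _ => hint e]
    simp_rw [hinv]
    simp
  have hle : ∫ ω, ∑ e : m → Bool, ‖∑ k, U ω i k * (if e k then 1 else -1)‖ ^ (2 * r) / N ^ r ∂P
      ≤ ∫ _, 2 ^ Fintype.card m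
        * (2 ^ r * (4 * (2 * r).factorial * Real.exp (1 / 2))) / N ^ r ∂P := by
    refine integral_mono (integrable_finsetSum _ fun e _ => hint e) (integrable_const _)
      fun ω => ?_
    simp only [← Finset.sum_div]
    gcongr
    exact sum_sign_norm_pow_le r _ (sum_norm_sq_row_eq_one (hUu ω) i)
  rw [← hsum, integral_const, probReal_univ, one_smul, mul_div_assoc] at hle
  exact le_of_mul_le_mul_left hle (by positivity)

theorem prod_le_sum_pow_card {ι : Type*} [Fintype ι] [Nonempty ι] (y : ι → ℝ)
    (hy : ∀ i, 0 ≤ y i) : ∏ i, y i ≤ ∑ i, y i ^ Fintype.card ι := by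
  obtain ⟨i, -, hi⟩ := Finset.exists_max_image univ y univ_nonempty
  calc ∏ j, y j ≤ ∏ _j : ι, y i := Finset.prod_le_prod (fun j _ => hy j) fun j hj => hi j hj
    _ = y i ^ Fintype.card ι := by simp
    _ ≤ _ := Finset.single_le_sum (f := fun i => y i ^ Fintype.card ι)
        (fun j _ => pow_nonneg (hy j) _) (mem_univ i)

theorem exists_integral_prod_entries_le (r : ℕ) : ∃ K : ℝ, 0 ≤ K ∧
    ∀ {Ω m : Type} [MeasurableSpace Ω] [Fintype m]
    [DecidableEq m] {P : Measure Ω} [IsProbabilityMeasure P] {U : Ω → Matrix m m ℂ}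
    (_ : Measurable U) (hUu : ∀ ω, U ω ∈ Matrix.unitaryGroup m ℂ)
    (_ : (Measure.map (fun ω => (⟨U ω, hUu ω⟩ : Matrix.unitaryGroup m ℂ)) P).IsHaarMeasure)
    (i : m) (c : Fin r → m),
    ∫ ω, ∏ j, ‖U ω i (c j)‖ ^ 2 ∂P ≤ K / (Fintype.card m : ℝ) ^ r := by
  rcases Nat.eq_zero_or_pos r with rfl | hr
  · exact ⟨1, zero_le_one, fun {Ω m} _ _ _ {P} _ U hU hUu hH i c => by simp⟩
  refine ⟨r * (2 ^ r * (4 * (2 * r).factorial * Real.exp (1 / 2))), by positivity,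
    fun {Ω m} _ _ _ {P} _ U hU hUu hH i c => ?_⟩
  have : Nonempty (Fin r) := ⟨⟨0, hr⟩⟩
  have hint : ∀ j, Integrable (fun ω => (‖U ω i (c j)‖ ^ 2) ^ r) P := fun j => by
    simpa using integrable_prod_entries (P := P) hU hUu i (fun _ : Fin r => c j)
  calc ∫ ω, ∏ j, ‖U ω i (c j)‖ ^ 2 ∂P ≤ ∫ ω, ∑ j, (‖U ω i (c j)‖ ^ 2) ^ r ∂P := by
        refine integral_mono (integrable_prod_entries hU hUu i c)
          (integrable_finsetSum _ fun j _ => hint j) fun ω => ?_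
        simpa using prod_le_sum_pow_card (fun j => ‖U ω i (c j)‖ ^ 2) fun _ => by positivity
    _ = ∑ j, ∫ ω, (‖U ω i (c j)‖ ^ 2) ^ r ∂P := integral_finsetSum _ fun j _ => hint j
    _ ≤ ∑ _j : Fin r, (2 ^ r * (4 * (2 * r).factorial * Real.exp (1 / 2)))
          / (Fintype.card m : ℝ) ^ r :=
        Finset.sum_le_sum fun j _ => integral_entry_pow_le hU hUu hH r i (c j)
    _ = _ := by simp [mul_div_assoc]

theorem integral_prod_entries_perm {Ω m ι : Type*} [MeasurableSpace Ω] [Fintype m]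
    [DecidableEq m] [Fintype ι] {P : Measure Ω} [IsProbabilityMeasure P] {U : Ω → Matrix m m ℂ}
    (hU : Measurable U) (hUu : ∀ ω, U ω ∈ Matrix.unitaryGroup m ℂ)
    (hH : (Measure.map (fun ω => (⟨U ω, hUu ω⟩ : Matrix.unitaryGroup m ℂ)) P).IsHaarMeasure)
    (i : m) (c : ι → m) (σ : Equiv.Perm m) :
    ∫ ω, ∏ j, ‖U ω i (σ (c j))‖ ^ 2 ∂P = ∫ ω, ∏ j, ‖U ω i (c j)‖ ^ 2 ∂P := by
  have hV : (1 : Matrix m m ℂ).submatrix id σ ∈ Matrix.unitaryGroup m ℂ := by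
    rw [Matrix.mem_unitaryGroup_iff', Matrix.star_eq_conjTranspose, Matrix.conjTranspose_submatrix,
      Matrix.conjTranspose_one, ← Matrix.submatrix_mul _ _ σ id σ Function.bijective_id, mul_one,
      Matrix.submatrix_one_equiv]
  have hf : Measurable fun A : Matrix m m ℂ => ∏ j, ‖A i (c j)‖ ^ 2 :=
    Finset.measurable_prod _ fun j _ =>
      ((measurable_pi_apply (c j)).comp (measurable_pi_apply i)).norm.pow_const 2
  rw [← integral_haar_unitary_mul_right hU hUu hH ⟨_, hV⟩ hf]
  congr! 5 with ω j
  rw [Matrix.mul_apply]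
  simp [Matrix.one_apply]

theorem pow_le_descFactorial_add (N r : ℕ) :
    N ^ r ≤ N.descFactorial r + r ^ 2 * N ^ (r - 1) := by
  induction r with
  | zero => simp
  | succ r ih =>
    rw [Nat.descFactorial_succ, Nat.add_sub_cancel]
    have h1 : N ≤ (N - r) + r := by omega
    have h2 := Nat.descFactorial_le_pow N r
    have h3 : N * (r ^ 2 * N ^ (r - 1)) ≤ r ^ 2 * N ^ r := by
      rcases r with _ | r
      · simp
      · rw [Nat.add_sub_cancel, pow_succ N]; exact le_of_eq (by ring)
    have h4 : N * N.descFactorial r ≤ (N - r) * N.descFactorial r + r * N.descFactorial r := by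
      rw [← add_mul]; gcongr
    have h5 : r * N.descFactorial r ≤ r * N ^ r := by gcongr
    calc N ^ (r + 1) = N * N ^ r := by ring
      _ ≤ N * (N.descFactorial r + r ^ 2 * N ^ (r - 1)) := by gcongr
      _ ≤ (N - r) * N.descFactorial r + r * N ^ r + r ^ 2 * N ^ r := by linarith
      _ ≤ _ := by nlinarith [Nat.zero_le (N ^ r), Nat.zero_le (r * N ^ r)]

theorem card_not_injective_le (r : ℕ) (m : Type*) [Fintype m] [DecidableEq m] :
    #{c : Fin r → m | ¬ Function.Injective c} ≤ r ^ 2 * Fintype.card m ^ (r - 1) := by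
  have h1 : #{c : Fin r → m | Function.Injective c} = (Fintype.card m).descFactorial r := by
    have := Fintype.card_embedding_eq (α := Fin r) (β := m)
    rw [Fintype.card_fin] at this
    rw [← this, ← Fintype.card_subtype]
    exact Fintype.card_congr (Equiv.subtypeInjectiveEquivEmbedding _ _)
  have h2 := Finset.card_filter_add_card_filter_not (s := (univ : Finset (Fin r → m)))
    (fun c => Function.Injective c)
  have h3 := pow_le_descFactorial_add (Fintype.card m) r
  have h4 : #(univ : Finset (Fin r → m)) = Fintype.card m ^ r := by simp
  omega

/-- The joint moments of the squared moduli of a row of a Haar unitary matrix are close to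
`N ^ (-r)`, in total variation up to order `1 / N`. -/
theorem exists_sum_abs_entries_sub_le (r : ℕ) : ∃ K : ℝ, 0 ≤ K ∧
    ∀ {Ω m : Type} [MeasurableSpace Ω] [Fintype m]
    [DecidableEq m] {P : Measure Ω} [IsProbabilityMeasure P] {U : Ω → Matrix m m ℂ}
    (_ : Measurable U) (hUu : ∀ ω, U ω ∈ Matrix.unitaryGroup m ℂ)
    (_ : (Measure.map (fun ω => (⟨U ω, hUu ω⟩ : Matrix.unitaryGroup m ℂ)) P).IsHaarMeasure)
    (i : m),
    ∑ c : Fin r → m, |∫ ω, ∏ j, ‖U ω i (c j)‖ ^ 2 ∂P - 1 / (Fintype.card m : ℝ) ^ r|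
      ≤ K / Fintype.card m := by
  obtain ⟨K, hK, hE⟩ := exists_integral_prod_entries_le r
  refine ⟨2 * (r ^ 2 * (K + 1)), by positivity, fun {Ω m} _ _ _ {P} _ U hU hUu hH i => ?_⟩
  set N : ℝ := (Fintype.card m : ℝ) with hN
  have hNpos : 0 < N := by rw [hN]; exact_mod_cast Fintype.card_pos_iff.2 ⟨i⟩
  set D : (Fin r → m) → ℝ := fun c => ∫ ω, ∏ j, ‖U ω i (c j)‖ ^ 2 ∂P - 1 / N ^ r with hD
  have htot : ∑ c, D c = 0 := by
    have h1 : ∑ c : Fin r → m, ∫ ω, ∏ j, ‖U ω i (c j)‖ ^ 2 ∂P = 1 := by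
      rw [← integral_finsetSum _ fun c _ => integrable_prod_entries hU hUu i c]
      have : ∀ ω, ∑ c : Fin r → m, ∏ j, ‖U ω i (c j)‖ ^ 2 = 1 := fun ω => by
        have := Finset.prod_univ_sum (fun _ : Fin r => (univ : Finset m))
          (fun _ k => ‖U ω i k‖ ^ 2)
        rw [Fintype.piFinset_univ] at this
        rw [← this]
        simp [sum_norm_sq_row_eq_one (hUu ω) i]
      simp [this]
    rw [hD, Finset.sum_sub_distrib, h1]
    simp [← hN, hNpos.ne']
  have hbd : ∀ c, |D c| ≤ (K + 1) / N ^ r := fun c => by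
    have h1 := hE hU hUu hH i c
    have h2 : 0 ≤ ∫ ω, ∏ j, ‖U ω i (c j)‖ ^ 2 ∂P := integral_nonneg fun ω => by positivity
    have h3 : 0 ≤ 1 / N ^ r := by positivity
    have h4 : 0 ≤ K / N ^ r := by positivity
    rw [add_div, abs_le]
    constructor <;> simp only [hD] <;> linarith
  have hsplit := fun f : (Fin r → m) → ℝ =>
    Finset.sum_filter_add_sum_filter_not univ (fun c : Fin r → m => Function.Injective c) f
  have hinj : ∑ c with Function.Injective c, |D c| = |∑ c with Function.Injective c, D c| := by
    by_cases he : ∃ c : Fin r → m, Function.Injective c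
    · obtain ⟨c₀, hc₀⟩ := he
      have hconst : ∀ c ∈ ({c | Function.Injective c} : Finset (Fin r → m)), D c = D c₀ := by
        intro c hc
        obtain ⟨σ, hσ⟩ := Equiv.Perm.exists_extending_pair c₀ c hc₀
          (Finset.mem_filter.1 hc).2
        have := integral_prod_entries_perm hU hUu hH i c₀ σ
        simp only [hσ] at this
        simp only [hD, this]
      rw [Finset.sum_congr rfl hconst, Finset.sum_congr rfl fun c hc => by rw [hconst c hc]]
      simp [abs_mul]
    · have : ({c | Function.Injective c} : Finset (Fin r → m)) = ∅ :=
        Finset.filter_eq_empty_iff.2 fun c _ hc => he ⟨c, hc⟩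
      simp [this]
  have hneg : ∑ c with Function.Injective c, D c = -∑ c with ¬ Function.Injective c, D c := by
    linarith [hsplit D]
  have hcard : (#{c : Fin r → m | ¬ Function.Injective c} : ℝ) ≤ r ^ 2 * N ^ (r - 1) := by
    rw [hN]; exact_mod_cast card_not_injective_le r m
  have hnon : ∑ c with ¬ Function.Injective c, |D c| ≤ r ^ 2 * (K + 1) / N := by
    rcases Nat.eq_zero_or_pos r with rfl | hr
    · rw [Finset.filter_eq_empty_iff.2 fun c _ hc => hc (Function.injective_of_subsingleton c)]
      simp
    calc ∑ c with ¬ Function.Injective c, |D c|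
        ≤ #{c : Fin r → m | ¬ Function.Injective c} • ((K + 1) / N ^ r) :=
          Finset.sum_le_card_nsmul _ _ _ fun c _ => hbd c
      _ ≤ (r ^ 2 * N ^ (r - 1)) * ((K + 1) / N ^ r) := by
          rw [nsmul_eq_mul]; gcongr
      _ = r ^ 2 * (K + 1) / N := by
          obtain ⟨s, rfl⟩ : ∃ s, r = s + 1 := ⟨r - 1, by omega⟩
          simp only [Nat.add_sub_cancel, pow_succ N]
          field_simp
  calc ∑ c, |D c| = |∑ c with ¬ Function.Injective c, D c|
        + ∑ c with ¬ Function.Injective c, |D c| := by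
        rw [← hsplit, hinj, hneg, abs_neg]
    _ ≤ ∑ c with ¬ Function.Injective c, |D c| + ∑ c with ¬ Function.Injective c, |D c| := by
        gcongr; exact Finset.abs_sum_le_sum_abs _ _
    _ ≤ 2 * (r ^ 2 * (K + 1)) / N := by rw [mul_div_assoc]; linarith

theorem abs_prod_pow_le {ι : Type*} [Fintype ι] (x : ι → ℝ) (j : ι → ℕ) :
    |∏ i, x i ^ j i| ≤ 1 + ∑ i, x i ^ (2 * ∑ i, j i) := by
  set k := ∑ i, j i with hk
  have hnn : ∀ i, 0 ≤ x i ^ (2 * k) := fun i => (even_two_mul k).pow_nonneg _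
  simp_rw [Finset.abs_prod, abs_pow]
  by_cases h : ∀ i, |x i| ≤ 1
  · have := Finset.sum_nonneg fun i (_ : i ∈ univ) => hnn i
    have := Finset.prod_le_one (s := univ) (f := fun i => |x i| ^ j i)
      (fun i _ => by positivity) fun i _ => pow_le_one₀ (abs_nonneg _) (h i)
    linarith
  · push Not at h
    obtain ⟨i₀, h₀⟩ := h
    obtain ⟨i, -, hi⟩ := Finset.exists_max_image univ (fun i => |x i|) ⟨i₀, mem_univ _⟩
    have h1 : 1 ≤ |x i| := h₀.le.trans (hi i₀ (mem_univ _))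
    calc ∏ l, |x l| ^ j l ≤ ∏ l, |x i| ^ j l :=
          Finset.prod_le_prod (fun l _ => by positivity) fun l hl =>
            pow_le_pow_left₀ (abs_nonneg _) (hi l hl) _
      _ = |x i| ^ k := by rw [Finset.prod_pow_eq_pow_sum]
      _ ≤ |x i| ^ (2 * k) := pow_le_pow_right₀ h1 (by omega)
      _ = x i ^ (2 * k) := (even_two_mul k).pow_abs _
      _ ≤ ∑ l, x l ^ (2 * k) :=
          Finset.single_le_sum (f := fun l => x l ^ (2 * k)) (fun l _ => hnn l) (mem_univ i)
      _ ≤ _ := by linarith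

/-- A weight on tuples that is invariant under the permutations of the alphabet sees only the
mean of a function of one letter. -/
theorem sum_mul_apply_of_perm_invariant {ι : Type*} [Fintype ι] [DecidableEq ι] {n : ℕ}
    (w : (ι → Fin (n + 1)) → ℝ)
    (hw : ∀ (σ : Equiv.Perm (Fin (n + 1))) c, w (fun i => σ (c i)) = w c)
    (G : Fin (n + 1) → ℝ) (i : ι) :
    ∑ c, w c * G (c i) = (∑ c, w c) * (1 / (n + 1 : ℝ) * ∑ p, G p) := by
  have h1 : ∀ s : Fin (n + 1), ∑ c, w c * G (c i) = ∑ c, w c * G (c i + s) := fun s => by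
    rw [← Equiv.sum_comp (Equiv.piCongrRight fun _ : ι => Equiv.addRight s)]
    refine Finset.sum_congr rfl fun c _ => ?_
    rw [← hw (Equiv.addRight s) c]
    rfl
  have h2 : ((n : ℝ) + 1) * ∑ c, w c * G (c i) = (∑ c, w c) * ∑ p, G p := by
    calc ((n : ℝ) + 1) * ∑ c, w c * G (c i) = ∑ s : Fin (n + 1), ∑ c, w c * G (c i) := by simp
      _ = ∑ s : Fin (n + 1), ∑ c, w c * G (c i + s) := Finset.sum_congr rfl fun s _ => h1 s
      _ = ∑ c, w c * ∑ s, G (c i + s) := by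
          rw [Finset.sum_comm]; simp_rw [Finset.mul_sum]
      _ = ∑ c, w c * ∑ p, G p :=
          Finset.sum_congr rfl fun c _ => by
            rw [← Equiv.sum_comp (Equiv.addLeft (c i)) G]; rfl
      _ = _ := by rw [Finset.sum_mul]
  have : (n : ℝ) + 1 ≠ 0 := by positivity
  field_simp
  linarith

theorem abs_integral_prod_sub_le {Ω : Type} [MeasurableSpace Ω] {P : Measure Ω}
    [IsProbabilityMeasure P] {n r : ℕ} {U : Ω → Matrix (Fin (n + 1)) (Fin (n + 1)) ℂ}
    {D : Ω → Fin (n + 1) → ℝ} (hU : Measurable U) (hD : Measurable D)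
    (hUu : ∀ ω, U ω ∈ Matrix.unitaryGroup (Fin (n + 1)) ℂ)
    (hH : (Measure.map
      (fun ω => (⟨U ω, hUu ω⟩ : Matrix.unitaryGroup (Fin (n + 1)) ℂ)) P).IsHaarMeasure)
    (hind : IndepFun U D P)
    (hint : ∀ k, Integrable (fun ω => 1 / (n + 1 : ℝ) * ∑ p, D ω p ^ k) P)
    (i : Fin (n + 1)) (j : Fin r → ℕ) :
    Integrable (fun ω => ∏ l, ∑ p, ‖U ω i p‖ ^ 2 * D ω p ^ j l) P ∧
    Integrable (fun ω => ∏ l, (1 / (n + 1 : ℝ) * ∑ p, D ω p ^ j l)) P ∧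
    |∫ ω, ∏ l, ∑ p, ‖U ω i p‖ ^ 2 * D ω p ^ j l ∂P
        - ∫ ω, ∏ l, (1 / (n + 1 : ℝ) * ∑ p, D ω p ^ j l) ∂P|
      ≤ (∑ c : Fin r → Fin (n + 1),
          |∫ ω, ∏ l, ‖U ω i (c l)‖ ^ 2 ∂P - 1 / ((Fintype.card (Fin (n + 1)) : ℕ) : ℝ) ^ r|)
        * (1 + r * ∫ ω, 1 / (n + 1 : ℝ) * ∑ p, D ω p ^ (2 * ∑ l, j l) ∂P) := by
  have hN : (0 : ℝ) < n + 1 := by positivity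
  have hDm : ∀ p, Measurable fun ω => D ω p := fun p => (measurable_pi_apply p).comp hD
  set k := ∑ l, j l with hk
  have hsumint : ∀ k, Integrable (fun ω => ∑ p, D ω p ^ k) P := fun k => by
    convert (hint k).const_mul (n + 1 : ℝ) using 2
    field_simp
  have hDint : ∀ p, Integrable (fun ω => D ω p ^ (2 * k)) P := fun p =>
    (hsumint (2 * k)).mono' ((hDm p).pow_const _).aestronglyMeasurable <| ae_of_all _ fun ω => by
      rw [Real.norm_of_nonneg ((even_two_mul k).pow_nonneg _)]
      exact Finset.single_le_sum (f := fun p => D ω p ^ (2 * k))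
        (fun q _ => (even_two_mul k).pow_nonneg _) (mem_univ p)
  have hcm : ∀ c : Fin r → Fin (n + 1), Measurable fun d : Fin (n + 1) → ℝ =>
      ∏ l, d (c l) ^ j l := fun c =>
    Finset.measurable_prod _ fun l _ => (measurable_pi_apply (c l)).pow_const _
  have hbint : ∀ c : Fin r → Fin (n + 1),
      Integrable (fun ω => 1 + ∑ l, D ω (c l) ^ (2 * k)) P := fun c =>
    (integrable_const _).add (integrable_finsetSum _ fun l _ => hDint (c l))
  have hcint : ∀ c : Fin r → Fin (n + 1), Integrable (fun ω => ∏ l, D ω (c l) ^ j l) P :=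
    fun c => (hbint c).mono' ((hcm c).comp hD).aestronglyMeasurable <| ae_of_all _ fun ω =>
      abs_prod_pow_le (fun l => D ω (c l)) j
  have hum : ∀ c : Fin r → Fin (n + 1), Measurable fun A : Matrix (Fin (n + 1)) (Fin (n + 1)) ℂ =>
      ∏ l, ‖A i (c l)‖ ^ 2 := fun c => Finset.measurable_prod _ fun l _ =>
    ((measurable_pi_apply (c l)).comp (measurable_pi_apply i)).norm.pow_const 2
  have huint := fun c : Fin r → Fin (n + 1) => integrable_prod_entries (P := P) hU hUu i c
  have hindc : ∀ c : Fin r → Fin (n + 1), IndepFun (fun ω => ∏ l, ‖U ω i (c l)‖ ^ 2)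
      (fun ω => ∏ l, D ω (c l) ^ j l) P := fun c => hind.comp (hum c) (hcm c)
  have hmulint : ∀ c : Fin r → Fin (n + 1), Integrable
      (fun ω => (∏ l, ‖U ω i (c l)‖ ^ 2) * ∏ l, D ω (c l) ^ j l) P :=
    fun c => (hindc c).integrable_mul (huint c) (hcint c)
  have hA : ∀ ω, ∏ l, ∑ p, ‖U ω i p‖ ^ 2 * D ω p ^ j l
      = ∑ c : Fin r → Fin (n + 1), (∏ l, ‖U ω i (c l)‖ ^ 2) * ∏ l, D ω (c l) ^ j l := fun ω => by
    rw [Finset.prod_univ_sum, Fintype.piFinset_univ]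
    simp_rw [Finset.prod_mul_distrib]
  have hM : ∀ ω, ∏ l, (1 / (n + 1 : ℝ) * ∑ p, D ω p ^ j l)
      = ∑ c : Fin r → Fin (n + 1), (1 / (n + 1 : ℝ) ^ r) * ∏ l, D ω (c l) ^ j l := fun ω => by
    rw [Finset.prod_mul_distrib, Finset.prod_univ_sum, Fintype.piFinset_univ, ← Finset.mul_sum]
    simp
  simp_rw [hA, hM]
  refine ⟨integrable_finsetSum _ fun c _ => hmulint c,
    integrable_finsetSum _ fun c _ => (hcint c).const_mul _, ?_⟩
  rw [integral_finsetSum _ fun c _ => hmulint c,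
    integral_finsetSum _ fun c _ => (hcint c).const_mul _, ← Finset.sum_sub_distrib]
  set w : (Fin r → Fin (n + 1)) → ℝ := fun c =>
    |∫ ω, ∏ l, ‖U ω i (c l)‖ ^ 2 ∂P - 1 / ((Fintype.card (Fin (n + 1)) : ℕ) : ℝ) ^ r| with hw
  have hwσ : ∀ (σ : Equiv.Perm (Fin (n + 1))) c, w (fun l => σ (c l)) = w c := fun σ c => by
    simp only [hw, integral_prod_entries_perm hU hUu hH i c σ]
  have hterm : ∀ c : Fin r → Fin (n + 1),
      |∫ ω, (∏ l, ‖U ω i (c l)‖ ^ 2) * ∏ l, D ω (c l) ^ j l ∂P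
        - ∫ ω, 1 / (n + 1 : ℝ) ^ r * ∏ l, D ω (c l) ^ j l ∂P|
      ≤ w c * (1 + ∑ l, ∫ ω, D ω (c l) ^ (2 * k) ∂P) := fun c => by
    have h1 : ∫ ω, (∏ l, ‖U ω i (c l)‖ ^ 2) * ∏ l, D ω (c l) ^ j l ∂P
        = (∫ ω, ∏ l, ‖U ω i (c l)‖ ^ 2 ∂P) * ∫ ω, ∏ l, D ω (c l) ^ j l ∂P :=
      (hindc c).integral_mul_eq_mul_integral (huint c).1 (hcint c).1
    have h2 : |∫ ω, ∏ l, D ω (c l) ^ j l ∂P| ≤ 1 + ∑ l, ∫ ω, D ω (c l) ^ (2 * k) ∂P := by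
      calc |∫ ω, ∏ l, D ω (c l) ^ j l ∂P| ≤ ∫ ω, |∏ l, D ω (c l) ^ j l| ∂P :=
            abs_integral_le_integral_abs
        _ ≤ ∫ ω, (1 + ∑ l, D ω (c l) ^ (2 * k)) ∂P :=
            integral_mono (hcint c).abs (hbint c) fun ω =>
              abs_prod_pow_le (fun l => D ω (c l)) j
        _ = _ := by
            rw [integral_add (integrable_const _)
              (integrable_finsetSum _ fun l _ => hDint (c l)),
              integral_finsetSum _ fun l _ => hDint (c l)]
            simp
    rw [h1, integral_const_mul, ← sub_mul, abs_mul]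
    refine mul_le_mul (le_of_eq ?_) h2 (abs_nonneg _) (abs_nonneg _)
    simp [hw]
  refine (Finset.abs_sum_le_sum_abs _ _).trans
    ((Finset.sum_le_sum fun c _ => hterm c).trans (le_of_eq ?_))
  simp_rw [mul_add, mul_one, Finset.sum_add_distrib, Finset.mul_sum]
  rw [Finset.sum_comm]
  simp_rw [sum_mul_apply_of_perm_invariant w hwσ (fun p => ∫ ω, D ω p ^ (2 * k) ∂P)]
  rw [← integral_finsetSum _ fun p _ => hDint p, ← integral_const_mul]
  simp [Finset.mul_sum]
  ring

theorem unitary_conj_diagonal_pow {m : Type*} [Fintype m] [DecidableEq m] {V : Matrix m m ℂ}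
    (hV : V ∈ Matrix.unitaryGroup m ℂ) (d : m → ℂ) (k : ℕ) :
    (V * Matrix.diagonal d * star V) ^ k = V * Matrix.diagonal (fun i => d i ^ k) * star V := by
  induction k with
  | zero => simp [Matrix.mem_unitaryGroup_iff.1 hV]
  | succ k ih =>
    rw [pow_succ, ih]
    calc V * Matrix.diagonal (fun i => d i ^ k) * star V * (V * Matrix.diagonal d * star V)
        = V * Matrix.diagonal (fun i => d i ^ k) * (star V * V) * Matrix.diagonal d * star V := by
          simp only [Matrix.mul_assoc]
      _ = _ := by
          rw [Matrix.mem_unitaryGroup_iff'.1 hV, Matrix.mul_one, Matrix.mul_assoc V,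
            Matrix.diagonal_mul_diagonal]
          simp [pow_succ]

theorem trace_unitary_conj_diagonal_pow {m : Type*} [Fintype m] [DecidableEq m]
    {V : Matrix m m ℂ} (hV : V ∈ Matrix.unitaryGroup m ℂ) (d : m → ℂ) (k : ℕ) :
    ((V * Matrix.diagonal d * star V) ^ k).trace = ∑ i, d i ^ k := by
  rw [unitary_conj_diagonal_pow hV, Matrix.trace_mul_comm, ← Matrix.mul_assoc,
    Matrix.mem_unitaryGroup_iff'.1 hV, Matrix.one_mul, Matrix.trace_diagonal]

theorem unitary_conj_diagonal_pow_apply_self {m : Type*} [Fintype m] [DecidableEq m]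
    {V : Matrix m m ℂ} (hV : V ∈ Matrix.unitaryGroup m ℂ) (d : m → ℝ) (k : ℕ) (i : m) :
    ((V * Matrix.diagonal (fun p => (d p : ℂ)) * star V) ^ k) i i
      = ((∑ p, ‖V i p‖ ^ 2 * d p ^ k : ℝ) : ℂ) := by
  rw [unitary_conj_diagonal_pow hV, Matrix.mul_apply]
  push_cast
  refine Finset.sum_congr rfl fun p _ => ?_
  rw [Matrix.mul_diagonal, Matrix.star_apply, RCLike.star_def, mul_right_comm, Complex.mul_conj,
    Complex.normSq_eq_norm_sq]
  push_cast
  rfl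

theorem det_one_sub_X_smul_unitary_conj_diagonal {m : Type*} [Fintype m] [DecidableEq m]
    {V : Matrix m m ℂ} (hV : V ∈ Matrix.unitaryGroup m ℂ) (d : m → ℂ) :
    (1 - (PowerSeries.X : PowerSeries ℂ) •
        (V * Matrix.diagonal d * star V).map (PowerSeries.C (R := ℂ))).det
      = ∏ i, (1 - PowerSeries.X * PowerSeries.C (d i)) := by
  have h1 : V.map (PowerSeries.C (R := ℂ)) * (star V).map (PowerSeries.C (R := ℂ)) = 1 := by
    rw [← Matrix.map_mul, Matrix.mem_unitaryGroup_iff.1 hV]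
    simp
  have h2 : 1 - (PowerSeries.X : PowerSeries ℂ) •
        (V * Matrix.diagonal d * star V).map (PowerSeries.C (R := ℂ))
      = V.map (PowerSeries.C (R := ℂ))
        * Matrix.diagonal (fun i => 1 - PowerSeries.X * PowerSeries.C (d i))
        * (star V).map (PowerSeries.C (R := ℂ)) := by
    have h3 : Matrix.diagonal (fun i => 1 - PowerSeries.X * PowerSeries.C (d i))
        = 1 - (PowerSeries.X : PowerSeries ℂ) •
          Matrix.diagonal (fun i => PowerSeries.C (R := ℂ) (d i)) := by
      ext i j : 2
      by_cases h : i = j <;> simp [h]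
    rw [h3, Matrix.mul_sub, Matrix.sub_mul, Matrix.mul_one, h1, Matrix.map_mul, Matrix.map_mul,
      Matrix.diagonal_map (map_zero _), Matrix.mul_smul, Matrix.smul_mul]
  rw [h2, Matrix.det_mul, Matrix.det_mul, Matrix.det_diagonal, mul_right_comm, ← Matrix.det_mul,
    h1, Matrix.det_one, one_mul]

theorem derivative_prod_one_sub_X_mul_C {m : Type*} (s : Finset m) (d : m → ℂ) :
    PowerSeries.derivative ℂ (∏ i ∈ s, (1 - PowerSeries.X * PowerSeries.C (d i)))
      = -((∏ i ∈ s, (1 - PowerSeries.X * PowerSeries.C (d i)))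
          * PowerSeries.mk fun k => ∑ i ∈ s, d i ^ (k + 1)) := by
  classical
  induction s using Finset.induction_on with
  | empty => ext k; simp
  | insert i s hi ih =>
    have h1 : (1 - PowerSeries.X * PowerSeries.C (d i)) * PowerSeries.mk (fun k => d i ^ (k + 1))
        = PowerSeries.C (d i) := by
      ext k
      rw [sub_mul, one_mul, mul_assoc, map_sub]
      rcases k with _ | k
      · simp
      · rw [PowerSeries.coeff_succ_X_mul, PowerSeries.coeff_C_mul, PowerSeries.coeff_mk,
          PowerSeries.coeff_mk, PowerSeries.coeff_C]
        simp [pow_succ']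
    have h2 : (PowerSeries.mk fun k => ∑ i ∈ insert i s, d i ^ (k + 1))
        = PowerSeries.mk (fun k => d i ^ (k + 1))
          + PowerSeries.mk fun k => ∑ i ∈ s, d i ^ (k + 1) := by
      ext k; simp [Finset.sum_insert hi]
    have h3 : PowerSeries.derivative ℂ (1 - PowerSeries.X * PowerSeries.C (d i))
        = -PowerSeries.C (d i) := by
      simp
    rw [Finset.prod_insert hi, Derivation.leibniz, ih, h2, h3, smul_eq_mul, smul_eq_mul]
    linear_combination (∏ i ∈ s, (1 - PowerSeries.X * PowerSeries.C (d i))) * h1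

/-- The recursion expressing the differences of power sums of the eigenvalues of a matrix and of
its principal submatrix through the corner entries of the powers of the matrix. -/
theorem corner_pow_recursion {n : ℕ} {Y V : Matrix (Fin (n + 1)) (Fin (n + 1)) ℂ}
    {W : Matrix (Fin n) (Fin n) ℂ} {d : Fin (n + 1) → ℂ} {e : Fin n → ℂ}
    (hV : V ∈ Matrix.unitaryGroup (Fin (n + 1)) ℂ) (hY : Y = V * Matrix.diagonal d * star V)
    (hW : W ∈ Matrix.unitaryGroup (Fin n) ℂ)
    (hYW : Y.submatrix Fin.castSucc Fin.castSucc = W * Matrix.diagonal e * star W) (k : ℕ) :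
    ((k : ℂ) + 1) * (Y ^ (k + 1)) (Fin.last n) (Fin.last n)
      = ∑ p ∈ antidiagonal k, (∑ i, d i ^ (p.1 + 1) - ∑ i, e i ^ (p.1 + 1))
          * (Y ^ p.2) (Fin.last n) (Fin.last n) := by
  set B : Matrix (Fin (n + 1)) (Fin (n + 1)) (PowerSeries ℂ) :=
    1 - (PowerSeries.X : PowerSeries ℂ) • Y.map (PowerSeries.C (R := ℂ)) with hB
  set G : Matrix (Fin (n + 1)) (Fin (n + 1)) (PowerSeries ℂ) :=
    Matrix.of fun i j => PowerSeries.mk fun k => (Y ^ k) i j with hG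
  have hBG : B * G = 1 := by
    ext i j k
    rw [hB, Matrix.sub_mul, Matrix.one_mul, Matrix.smul_mul, Matrix.sub_apply, Matrix.smul_apply,
      Matrix.mul_apply, map_sub, smul_eq_mul, Matrix.one_apply]
    rcases k with _ | k
    · simp [hG, Matrix.one_apply]
    · rw [PowerSeries.coeff_succ_X_mul, map_sum]
      simp only [hG, Matrix.of_apply, Matrix.map_apply, PowerSeries.coeff_C_mul,
        PowerSeries.coeff_mk]
      rw [pow_succ', Matrix.mul_apply, sub_self]
      split_ifs <;> simp [PowerSeries.coeff_one]
  set A : PowerSeries ℂ := PowerSeries.mk fun k => (Y ^ k) (Fin.last n) (Fin.last n) with hA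
  set F : PowerSeries ℂ := ∏ i, (1 - PowerSeries.X * PowerSeries.C (d i)) with hF
  set H : PowerSeries ℂ := ∏ i, (1 - PowerSeries.X * PowerSeries.C (e i)) with hH
  have hdetB : B.det = F := by
    rw [hB, hY, det_one_sub_X_smul_unitary_conj_diagonal hV]
  have hFA : F * A = H := by
    have h1 : B.adjugate = B.det • G := by
      calc B.adjugate = B.adjugate * (B * G) := by rw [hBG, Matrix.mul_one]
        _ = B.det • G := by rw [← Matrix.mul_assoc, Matrix.adjugate_mul, Matrix.smul_mul,
            Matrix.one_mul]
    have h2 := congrFun (congrFun h1 (Fin.last n)) (Fin.last n)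
    rw [Matrix.adjugate_fin_succ_eq_det_submatrix, hdetB, Matrix.smul_apply, smul_eq_mul] at h2
    have h3 : B.submatrix (Fin.last n).succAbove (Fin.last n).succAbove
        = 1 - (PowerSeries.X : PowerSeries ℂ) •
          (W * Matrix.diagonal e * star W).map (PowerSeries.C (R := ℂ)) := by
      rw [← hYW, Fin.succAbove_last]
      ext i j : 2
      simp [hB, Matrix.one_apply]
    rw [h3, det_one_sub_X_smul_unitary_conj_diagonal hW] at h2
    rw [Even.neg_one_pow ⟨_, rfl⟩, one_mul] at h2
    exact h2.symm
  have hF0 : F ≠ 0 := fun h => by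
    have := congrArg (PowerSeries.constantCoeff (R := ℂ)) h
    simp [hF] at this
  have hdF := derivative_prod_one_sub_X_mul_C univ d
  have hdH := derivative_prod_one_sub_X_mul_C univ e
  rw [← hF] at hdF
  rw [← hH, ← hFA, Derivation.leibniz, hdF, smul_eq_mul, smul_eq_mul] at hdH
  have key : PowerSeries.derivative ℂ A
      = ((PowerSeries.mk fun k => ∑ i, d i ^ (k + 1))
        - PowerSeries.mk fun k => ∑ i, e i ^ (k + 1)) * A :=
    mul_left_cancel₀ hF0 (by linear_combination hdH)
  have := congrArg (PowerSeries.coeff (R := ℂ) k) key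
  rw [PowerSeries.coeff_derivative, PowerSeries.coeff_mul] at this
  simp only [hA, PowerSeries.coeff_mk, map_sub] at this
  rw [← this, mul_comm]

/-- The non-crossing partitions of a finite set of natural numbers. -/
noncomputable def ncPartitions (S : Finset ℕ) : Finset (Finset (Finset ℕ)) :=
  S.powerset.powerset.filter (IsNCPartitionOn S)

theorem mem_ncPartitions {S : Finset ℕ} {ρ : Finset (Finset ℕ)} :
    ρ ∈ ncPartitions S ↔ IsNCPartitionOn S ρ := by
  rw [ncPartitions, mem_filter, and_iff_right_iff_imp]
  intro h
  exact mem_powerset.2 fun B hB => mem_powerset.2 (h.1.2.1 B hB)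

theorem IsPartitionOn.eq_of_mem {S : Finset ℕ} {ρ : Finset (Finset ℕ)} (h : IsPartitionOn S ρ)
    {B C : Finset ℕ} (hB : B ∈ ρ) (hC : C ∈ ρ) {x : ℕ} (hxB : x ∈ B) (hxC : x ∈ C) : B = C :=
  (h.2.2 x (h.2.1 B hB hxB)).unique ⟨hB, hxB⟩ ⟨hC, hxC⟩

theorem IsPartitionOn.exists_mem {S : Finset ℕ} {ρ : Finset (Finset ℕ)} (h : IsPartitionOn S ρ)
    {x : ℕ} (hx : x ∈ S) : ∃ B ∈ ρ, x ∈ B :=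
  let ⟨B, hB, _⟩ := h.2.2 x hx
  ⟨B, hB.1, hB.2⟩

theorem isPartitionOn_of {S : Finset ℕ} {ρ : Finset (Finset ℕ)} (h1 : ∀ B ∈ ρ, B.Nonempty)
    (h2 : ∀ B ∈ ρ, B ⊆ S) (h3 : ∀ x ∈ S, ∃ B ∈ ρ, x ∈ B)
    (h4 : ∀ B ∈ ρ, ∀ C ∈ ρ, ∀ x, x ∈ B → x ∈ C → B = C) : IsPartitionOn S ρ :=
  ⟨h1, h2, fun x hx =>
    let ⟨B, hB, hxB⟩ := h3 x hx
    ⟨B, ⟨hB, hxB⟩, fun C hC => h4 C hC.1 B hB x hC.2 hxB⟩⟩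

section NCSum

variable {R : Type*} [CommRing R]

/-- The sum over the non-crossing partitions of `S` of the products of the weights of the sizes of
the blocks, the size of the block of `a` being increased by `j`. -/
noncomputable def ncSum (w : ℕ → R) (j a : ℕ) (S : Finset ℕ) : R :=
  ∑ ρ ∈ ncPartitions S, ∏ B ∈ ρ, w (if a ∈ B then B.card + j else B.card)

theorem ncSum_of_notMem (w : ℕ → R) (j : ℕ) {a : ℕ} {S : Finset ℕ} (ha : a ∉ S) :
    ncSum w j a S = ∑ ρ ∈ ncPartitions S, ∏ B ∈ ρ, w B.card := by
  refine sum_congr rfl fun ρ hρ => prod_congr rfl fun B hB => ?_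
  rw [if_neg fun h => ha ((mem_ncPartitions.1 hρ).1.2.1 B hB h)]

theorem ncSum_zero (w : ℕ → R) (a : ℕ) (S : Finset ℕ) :
    ncSum w 0 a S = ∑ ρ ∈ ncPartitions S, ∏ B ∈ ρ, w B.card :=
  sum_congr rfl fun ρ _ => prod_congr rfl fun B _ => by simp

theorem isNCPartitionOn_map_iff (f : ℕ ↪o ℕ) (S : Finset ℕ) (ρ : Finset (Finset ℕ)) :
    IsNCPartitionOn (S.map f.toEmbedding) (ρ.map (mapEmbedding f.toEmbedding).toEmbedding)
      ↔ IsNCPartitionOn S ρ := by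
  constructor
  · rintro ⟨h, h'⟩
    have hm : ∀ B ∈ ρ, B.map f.toEmbedding ∈ ρ.map (mapEmbedding f.toEmbedding).toEmbedding :=
      fun B hB => mem_map_of_mem (mapEmbedding f.toEmbedding).toEmbedding hB
    refine ⟨isPartitionOn_of ?_ ?_ ?_ ?_, ?_⟩
    · intro B hB
      exact map_nonempty.1 (h.1 _ (hm B hB))
    · intro B hB
      exact map_subset_map.1 (h.2.1 _ (hm B hB))
    · intro x hx
      obtain ⟨B, hB, hxB⟩ := h.exists_mem (mem_map_of_mem f.toEmbedding hx)
      obtain ⟨C, hC, rfl⟩ := mem_map.1 hB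
      exact ⟨C, hC, (mem_map' f.toEmbedding).1 hxB⟩
    · intro B hB C hC x hxB hxC
      exact map_injective f.toEmbedding (h.eq_of_mem (hm B hB) (hm C hC)
        (mem_map_of_mem f.toEmbedding hxB) (mem_map_of_mem f.toEmbedding hxC))
    · rintro B hB C hC hne ⟨a, b, c, d, ha, hb, hc, hd, h1, h2, h3⟩
      exact h' _ (hm B hB) _ (hm C hC) (fun h => hne (map_injective _ h))
        ⟨f a, f b, f c, f d, mem_map_of_mem f.toEmbedding ha, mem_map_of_mem f.toEmbedding hb,
          mem_map_of_mem f.toEmbedding hc, mem_map_of_mem f.toEmbedding hd, f.lt_iff_lt.2 h1,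
          f.lt_iff_lt.2 h2, f.lt_iff_lt.2 h3⟩
  · rintro ⟨h, h'⟩
    refine ⟨isPartitionOn_of ?_ ?_ ?_ ?_, ?_⟩
    · simp only [mem_map, forall_exists_index, and_imp]
      rintro _ B hB rfl
      exact map_nonempty.2 (h.1 B hB)
    · simp only [mem_map, forall_exists_index, and_imp]
      rintro _ B hB rfl
      exact map_subset_map.2 (h.2.1 B hB)
    · intro y hy
      obtain ⟨x, hx, rfl⟩ := mem_map.1 hy
      obtain ⟨B, hB, hxB⟩ := h.exists_mem hx
      exact ⟨_, mem_map_of_mem _ hB, mem_map_of_mem f.toEmbedding hxB⟩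
    · simp only [mem_map, forall_exists_index, and_imp]
      rintro _ B hB rfl _ C hC rfl x hxB hxC
      obtain ⟨y, hy, rfl⟩ := mem_map.1 hxB
      rw [h.eq_of_mem hB hC hy ((mem_map' f.toEmbedding).1 hxC)]
    · rintro B' hB' C' hC' hne ⟨a', b', c', d', ha', hb', hc', hd', h1, h2, h3⟩
      obtain ⟨B, hB, rfl⟩ := mem_map.1 hB'
      obtain ⟨C, hC, rfl⟩ := mem_map.1 hC'
      obtain ⟨a, ha, rfl⟩ := mem_map.1 ha'
      obtain ⟨b, hb, rfl⟩ := mem_map.1 hb'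
      obtain ⟨c, hc, rfl⟩ := mem_map.1 hc'
      obtain ⟨d, hd, rfl⟩ := mem_map.1 hd'
      exact h' B hB C hC (fun h => hne (h ▸ rfl)) ⟨a, b, c, d, ha, hb, hc, hd,
        f.lt_iff_lt.1 h1, f.lt_iff_lt.1 h2, f.lt_iff_lt.1 h3⟩

theorem ncSum_map (w : ℕ → R) (j a : ℕ) (S : Finset ℕ) (f : ℕ ↪o ℕ) :
    ncSum w j (f a) (S.map f.toEmbedding) = ncSum w j a S := by
  symm
  refine sum_bij (fun ρ _ => ρ.map (mapEmbedding f.toEmbedding).toEmbedding) ?_ ?_ ?_ ?_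
  · intro ρ hρ
    exact mem_ncPartitions.2 ((isNCPartitionOn_map_iff f S ρ).2 (mem_ncPartitions.1 hρ))
  · intro ρ _ σ _ h
    exact map_injective _ h
  · intro ρ hρ
    have h1 := mem_ncPartitions.1 hρ
    obtain ⟨σ, -, rfl⟩ : ∃ σ ⊆ S.powerset,
        ρ = σ.map (mapEmbedding f.toEmbedding).toEmbedding := by
      refine subset_map_iff.1 fun B hB => ?_
      obtain ⟨C, hC, rfl⟩ := subset_map_iff.1 (h1.1.2.1 B hB)
      exact mem_map_of_mem (mapEmbedding f.toEmbedding).toEmbedding (mem_powerset.2 hC)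
    exact ⟨σ, mem_ncPartitions.2 ((isNCPartitionOn_map_iff f S σ).1 h1), rfl⟩
  · intro ρ _
    rw [prod_map]
    refine prod_congr rfl fun B _ => ?_
    have : f a ∈ B.map f.toEmbedding ↔ a ∈ B := mem_map' f.toEmbedding
    simp [mapEmbedding_apply]

theorem ncSum_Ico (w : ℕ → R) (j a n : ℕ) :
    ncSum w j a (Ico a (a + n)) = ncSum w j 0 (Ico 0 n) := by
  rw [← ncSum_map w j 0 (Ico 0 n) (OrderEmbedding.addLeft a)]
  congr 1
  ext x
  simp only [mem_Ico, mem_map]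
  constructor
  · intro h
    exact ⟨x - a, by omega, by simp; omega⟩
  · rintro ⟨y, hy, rfl⟩
    simp; omega

/-- Non-crossing partitions of a union of two sets that do not cross each other. -/
theorem sum_ncPartitions_union {L T : Finset ℕ} (hd : Disjoint L T)
    (h1 : ∀ a ∈ L, ∀ b ∈ L, ∀ c ∈ T, ∀ d ∈ T, ¬ (a < c ∧ c < b ∧ b < d))
    (h2 : ∀ a ∈ T, ∀ b ∈ T, ∀ c ∈ L, ∀ d ∈ L, ¬ (a < c ∧ c < b ∧ b < d))
    (f : Finset ℕ → R) (P : Finset (Finset ℕ) → Prop) [DecidablePred P]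
    (hP : ∀ σ ⊆ L.powerset, ∀ τ ⊆ T.powerset, (P (σ ∪ τ) ↔ P τ)) :
    ∑ ρ ∈ ncPartitions (L ∪ T) with (∀ B ∈ ρ, B ⊆ L ∨ B ⊆ T) ∧ P ρ, ∏ B ∈ ρ, f B
      = (∑ σ ∈ ncPartitions L, ∏ B ∈ σ, f B) * ∑ τ ∈ ncPartitions T with P τ, ∏ B ∈ τ, f B := by
  have key : ∀ σ τ, IsPartitionOn L σ → IsPartitionOn T τ → Disjoint σ τ := by
    intro σ τ hσ hτ
    rw [Finset.disjoint_left]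
    intro B hB hB'
    obtain ⟨x, hx⟩ := hσ.1 B hB
    exact Finset.disjoint_left.1 hd (hσ.2.1 B hB hx) (hτ.2.1 B hB' hx)
  rw [sum_mul_sum, ← sum_product']
  symm
  refine sum_bij' (fun p _ => p.1 ∪ p.2)
    (fun ρ _ => (ρ.filter (· ⊆ L), ρ.filter (· ⊆ T))) ?_ ?_ ?_ ?_ ?_
  · rintro ⟨σ, τ⟩ h
    rw [mem_product, mem_filter, mem_ncPartitions, mem_ncPartitions] at h
    obtain ⟨⟨hσ, hσ'⟩, ⟨hτ, hτ'⟩, hPτ⟩ := h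
    dsimp only at *
    have hsub : ∀ B ∈ σ ∪ τ, B ⊆ L ∨ B ⊆ T := fun B hB =>
      (mem_union.1 hB).imp (hσ.2.1 B) (hτ.2.1 B)
    rw [mem_filter, mem_ncPartitions]
    refine ⟨⟨isPartitionOn_of ?_ ?_ ?_ ?_, ?_⟩, hsub, (hP σ ?_ τ ?_).2 hPτ⟩
    · exact fun B hB => (mem_union.1 hB).elim (hσ.1 B) (hτ.1 B)
    · exact fun B hB => (hsub B hB).elim (fun h => h.trans subset_union_left)
        fun h => h.trans subset_union_right
    · intro x hx
      rcases mem_union.1 hx with hx | hx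
      · obtain ⟨B, hB, hxB⟩ := hσ.exists_mem hx
        exact ⟨B, mem_union_left _ hB, hxB⟩
      · obtain ⟨B, hB, hxB⟩ := hτ.exists_mem hx
        exact ⟨B, mem_union_right _ hB, hxB⟩
    · intro B hB C hC x hxB hxC
      rcases mem_union.1 hB with hB | hB <;> rcases mem_union.1 hC with hC | hC
      · exact hσ.eq_of_mem hB hC hxB hxC
      · exact absurd (hτ.2.1 C hC hxC) (Finset.disjoint_left.1 hd (hσ.2.1 B hB hxB))
      · exact absurd (hτ.2.1 B hB hxB) (Finset.disjoint_left.1 hd (hσ.2.1 C hC hxC))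
      · exact hτ.eq_of_mem hB hC hxB hxC
    · rintro B hB C hC hne ⟨a, b, c, d, ha, hb, hc, hd', hlt⟩
      rcases mem_union.1 hB with hB | hB <;> rcases mem_union.1 hC with hC | hC
      · exact hσ' B hB C hC hne ⟨a, b, c, d, ha, hb, hc, hd', hlt⟩
      · exact h1 a (hσ.2.1 B hB ha) b (hσ.2.1 B hB hb) c (hτ.2.1 C hC hc) d (hτ.2.1 C hC hd') hlt
      · exact h2 a (hτ.2.1 B hB ha) b (hτ.2.1 B hB hb) c (hσ.2.1 C hC hc) d (hσ.2.1 C hC hd') hlt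
      · exact hτ' B hB C hC hne ⟨a, b, c, d, ha, hb, hc, hd', hlt⟩
    · exact fun B hB => mem_powerset.2 (hσ.2.1 B hB)
    · exact fun B hB => mem_powerset.2 (hτ.2.1 B hB)
  · intro ρ h
    rw [mem_filter, mem_ncPartitions] at h
    obtain ⟨⟨hρ, hρ'⟩, hsub, hPρ⟩ := h
    have hu : ρ.filter (· ⊆ L) ∪ ρ.filter (· ⊆ T) = ρ := by
      ext B
      simp only [mem_union, mem_filter]
      have := hsub B
      tauto
    rw [mem_product, mem_filter, mem_ncPartitions, mem_ncPartitions]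
    refine ⟨⟨isPartitionOn_of ?_ ?_ ?_ ?_, ?_⟩, ⟨isPartitionOn_of ?_ ?_ ?_ ?_, ?_⟩, ?_⟩
    · exact fun B hB => hρ.1 B (mem_filter.1 hB).1
    · exact fun B hB => (mem_filter.1 hB).2
    · intro x hx
      obtain ⟨B, hB, hxB⟩ := hρ.exists_mem (mem_union_left _ hx)
      refine ⟨B, mem_filter.2 ⟨hB, (hsub B hB).resolve_right fun h => ?_⟩, hxB⟩
      exact Finset.disjoint_left.1 hd hx (h hxB)
    · exact fun B hB C hC x => hρ.eq_of_mem (mem_filter.1 hB).1 (mem_filter.1 hC).1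
    · exact fun B hB C hC => hρ' B (mem_filter.1 hB).1 C (mem_filter.1 hC).1
    · exact fun B hB => hρ.1 B (mem_filter.1 hB).1
    · exact fun B hB => (mem_filter.1 hB).2
    · intro x hx
      obtain ⟨B, hB, hxB⟩ := hρ.exists_mem (mem_union_right _ hx)
      refine ⟨B, mem_filter.2 ⟨hB, (hsub B hB).resolve_left fun h => ?_⟩, hxB⟩
      exact Finset.disjoint_left.1 hd (h hxB) hx
    · exact fun B hB C hC x => hρ.eq_of_mem (mem_filter.1 hB).1 (mem_filter.1 hC).1
    · exact fun B hB C hC => hρ' B (mem_filter.1 hB).1 C (mem_filter.1 hC).1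
    · rw [← hP (ρ.filter (· ⊆ L)) ?_ _ ?_, hu]
      · exact hPρ
      · exact fun B hB => mem_powerset.2 (mem_filter.1 hB).2
      · exact fun B hB => mem_powerset.2 (mem_filter.1 hB).2
  · rintro ⟨σ, τ⟩ h
    rw [mem_product, mem_filter, mem_ncPartitions, mem_ncPartitions] at h
    obtain ⟨⟨hσ, hσ'⟩, ⟨hτ, hτ'⟩, -⟩ := h
    dsimp only at *
    refine Prod.ext ?_ ?_
    · ext B
      simp only [mem_filter, mem_union]
      constructor
      · rintro ⟨hB | hB, h⟩
        · exact hB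
        · obtain ⟨x, hx⟩ := hτ.1 B hB
          exact absurd (hτ.2.1 B hB hx) (Finset.disjoint_left.1 hd (h hx))
      · exact fun hB => ⟨Or.inl hB, hσ.2.1 B hB⟩
    · ext B
      simp only [mem_filter, mem_union]
      constructor
      · rintro ⟨hB | hB, h⟩
        · obtain ⟨x, hx⟩ := hσ.1 B hB
          exact absurd (h hx) (Finset.disjoint_left.1 hd (hσ.2.1 B hB hx))
        · exact hB
      · exact fun hB => ⟨Or.inr hB, hτ.2.1 B hB⟩
  · intro ρ h
    rw [mem_filter, mem_ncPartitions] at h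
    obtain ⟨-, hsub, -⟩ := h
    ext B
    simp only [mem_union, mem_filter]
    have := hsub B
    tauto
  · rintro ⟨σ, τ⟩ h
    rw [mem_product, mem_filter, mem_ncPartitions, mem_ncPartitions] at h
    exact (prod_union (key σ τ h.1.1 h.2.1.1)).symm

theorem sum_ncPartitions_insert (w : ℕ → R) (j : ℕ) {a b : ℕ} {T : Finset ℕ} (hab : a < b)
    (hbT : b ∈ T) (hT : ∀ x ∈ T, b ≤ x) :
    ∑ ρ ∈ ncPartitions (insert a T) with (∃ B ∈ ρ, a ∈ B ∧ b ∈ B),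
        ∏ B ∈ ρ, w (if a ∈ B then B.card + j else B.card)
      = ncSum w (j + 1) b T := by
  have haT : a ∉ T := fun h => absurd (hT a h) (by omega)
  set φ : Finset ℕ → Finset ℕ := fun B => if b ∈ B then insert a B else B with hφ
  have hφmem : ∀ B : Finset ℕ, ∀ x, x ≠ a → (x ∈ φ B ↔ x ∈ B) := by
    intro B x hx
    simp only [hφ]
    split_ifs <;> simp [hx]
  have hφa : ∀ B : Finset ℕ, a ∉ B → (a ∈ φ B ↔ b ∈ B) := by
    intro B hB
    simp only [hφ]
    split_ifs with h <;> simp [hB, h]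
  have hφerase : ∀ B : Finset ℕ, a ∉ B → (φ B).erase a = B := by
    intro B hB
    ext x
    rw [mem_erase]
    constructor
    · exact fun h => (hφmem B x h.1).1 h.2
    · intro h
      have hx : x ≠ a := fun h' => hB (h' ▸ h)
      exact ⟨hx, (hφmem B x hx).2 h⟩
  have haτ : ∀ τ, IsPartitionOn T τ → ∀ B ∈ τ, a ∉ B := fun τ hτ B hB h => haT (hτ.2.1 B hB h)
  symm
  refine sum_bij' (fun τ _ => τ.image φ) (fun ρ _ => ρ.image (·.erase a)) ?_ ?_ ?_ ?_ ?_
  · intro τ h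
    obtain ⟨hτ, hτ'⟩ := mem_ncPartitions.1 h
    have ha := haτ τ hτ
    rw [mem_filter, mem_ncPartitions]
    refine ⟨⟨isPartitionOn_of ?_ ?_ ?_ ?_, ?_⟩, ?_⟩
    · intro B' hB'
      obtain ⟨B, hB, rfl⟩ := mem_image.1 hB'
      obtain ⟨x, hx⟩ := hτ.1 B hB
      exact ⟨x, (hφmem B x fun h => ha B hB (h ▸ hx)).2 hx⟩
    · intro B' hB'
      obtain ⟨B, hB, rfl⟩ := mem_image.1 hB'
      intro x hx
      by_cases hxa : x = a
      · simp [hxa]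
      · exact mem_insert_of_mem (hτ.2.1 B hB ((hφmem B x hxa).1 hx))
    · intro x hx
      rcases mem_insert.1 hx with rfl | hx
      · obtain ⟨B, hB, hbB⟩ := hτ.exists_mem hbT
        exact ⟨φ B, mem_image_of_mem φ hB, (hφa B (ha B hB)).2 hbB⟩
      · obtain ⟨B, hB, hxB⟩ := hτ.exists_mem hx
        exact ⟨φ B, mem_image_of_mem φ hB, (hφmem B x fun h => ha B hB (h ▸ hxB)).2 hxB⟩
    · intro B' hB' C' hC' x hxB hxC
      obtain ⟨B, hB, rfl⟩ := mem_image.1 hB'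
      obtain ⟨C, hC, rfl⟩ := mem_image.1 hC'
      by_cases hxa : x = a
      · subst hxa
        rw [hτ.eq_of_mem hB hC ((hφa B (ha B hB)).1 hxB) ((hφa C (ha C hC)).1 hxC)]
      · rw [hτ.eq_of_mem hB hC ((hφmem B x hxa).1 hxB) ((hφmem C x hxa).1 hxC)]
    · rintro B' hB' C' hC' hne ⟨p, q, r, s, hp, hq, hr, hs, h1, h2, h3⟩
      obtain ⟨B, hB, rfl⟩ := mem_image.1 hB'
      obtain ⟨C, hC, rfl⟩ := mem_image.1 hC'
      have hBC : B ≠ C := fun h => hne (h ▸ rfl)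
      have hle : ∀ D ∈ τ, ∀ x ∈ φ D, x = a ∨ b ≤ x ∧ x ∈ D := by
        intro D hD x hx
        refine or_iff_not_imp_left.2 fun h => ?_
        have := (hφmem D x h).1 hx
        exact ⟨hT x (hτ.2.1 D hD this), this⟩
      have hq' := hle B hB q hq
      have hr' := hle C hC r hr
      have hs' := hle C hC s hs
      rcases hle B hB p hp with rfl | hp'
      · have hbB := (hφa B (ha B hB)).1 hp
        have hrb : r ≠ b := by
          rintro rfl
          exact hBC (hτ.eq_of_mem hB hC hbB (hr'.resolve_left (by omega)).2)
        exact hτ' B hB C hC hBC ⟨b, q, r, s, hbB, (hq'.resolve_left (by omega)).2,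
          (hr'.resolve_left (by omega)).2, (hs'.resolve_left (by omega)).2,
          by omega, h2, h3⟩
      · exact hτ' B hB C hC hBC ⟨p, q, r, s, hp'.2, (hq'.resolve_left (by omega)).2,
          (hr'.resolve_left (by omega)).2, (hs'.resolve_left (by omega)).2, h1, h2, h3⟩
    · obtain ⟨B, hB, hbB⟩ := hτ.exists_mem hbT
      exact ⟨φ B, mem_image_of_mem φ hB, (hφa B (ha B hB)).2 hbB,
        (hφmem B b (by omega)).2 hbB⟩
  · intro ρ h
    rw [mem_filter, mem_ncPartitions] at h
    obtain ⟨⟨hρ, hρ'⟩, A, hA, haA, hbA⟩ := h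
    have hAB : ∀ B ∈ ρ, a ∈ B → B = A := fun B hB h => hρ.eq_of_mem hB hA h haA
    rw [mem_ncPartitions]
    refine ⟨isPartitionOn_of ?_ ?_ ?_ ?_, ?_⟩
    · intro B' hB'
      obtain ⟨B, hB, rfl⟩ := mem_image.1 hB'
      by_cases h : a ∈ B
      · rw [hAB B hB h]
        exact ⟨b, mem_erase.2 ⟨by omega, hbA⟩⟩
      · rw [erase_eq_of_notMem h]
        exact hρ.1 B hB
    · intro B' hB'
      obtain ⟨B, hB, rfl⟩ := mem_image.1 hB'
      intro x hx
      rw [mem_erase] at hx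
      exact (mem_insert.1 (hρ.2.1 B hB hx.2)).resolve_left hx.1
    · intro x hx
      obtain ⟨B, hB, hxB⟩ := hρ.exists_mem (mem_insert_of_mem hx)
      exact ⟨_, mem_image_of_mem _ hB, mem_erase.2 ⟨fun h => haT (h ▸ hx), hxB⟩⟩
    · intro B' hB' C' hC' x hxB hxC
      obtain ⟨B, hB, rfl⟩ := mem_image.1 hB'
      obtain ⟨C, hC, rfl⟩ := mem_image.1 hC'
      rw [hρ.eq_of_mem hB hC (mem_erase.1 hxB).2 (mem_erase.1 hxC).2]
    · rintro B' hB' C' hC' hne ⟨p, q, r, s, hp, hq, hr, hs, h⟩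
      obtain ⟨B, hB, rfl⟩ := mem_image.1 hB'
      obtain ⟨C, hC, rfl⟩ := mem_image.1 hC'
      exact hρ' B hB C hC (fun h => hne (h ▸ rfl)) ⟨p, q, r, s, (mem_erase.1 hp).2,
        (mem_erase.1 hq).2, (mem_erase.1 hr).2, (mem_erase.1 hs).2, h⟩
  · intro τ h
    have ha := haτ τ (mem_ncPartitions.1 h).1
    rw [image_image]
    conv_rhs => rw [← image_id (s := τ)]
    exact image_congr fun B hB => hφerase B (ha B hB)
  · intro ρ h
    rw [mem_filter, mem_ncPartitions] at h
    obtain ⟨⟨hρ, -⟩, A, hA, haA, hbA⟩ := h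
    rw [image_image]
    conv_rhs => rw [← image_id (s := ρ)]
    refine image_congr fun B hB => ?_
    have hbB : b ∈ B ↔ a ∈ B := by
      constructor <;> intro h
      · rwa [hρ.eq_of_mem hB hA h hbA]
      · rwa [hρ.eq_of_mem hB hA h haA]
    simp only [Function.comp, hφ, id, mem_erase]
    by_cases h : a ∈ B
    · rw [if_pos ⟨by omega, hbB.2 h⟩, insert_erase h]
    · rw [if_neg fun h' => h (hbB.1 h'.2), erase_eq_of_notMem h]
  · intro τ h
    have ha := haτ τ (mem_ncPartitions.1 h).1
    rw [prod_image]
    · refine prod_congr rfl fun B hB => ?_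
      have h1 := hφa B (ha B hB)
      by_cases hb : b ∈ B
      · have h2 : φ B = insert a B := if_pos hb
        rw [if_pos hb, if_pos (h1.2 hb), h2, card_insert_of_notMem (ha B hB)]
        congr 1
        ring
      · have h2 : φ B = B := if_neg hb
        rw [if_neg hb, if_neg (fun h => hb (h1.1 h)), h2]
    · intro B hB C hC h
      rw [← hφerase B (ha B hB), ← hφerase C (ha C hC), h]

theorem ncPartitions_singleton (a : ℕ) : ncPartitions {a} = {{{a}}} := by
  ext ρ
  rw [mem_ncPartitions, mem_singleton]
  constructor
  · rintro ⟨h, -⟩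
    ext B
    rw [mem_singleton]
    constructor
    · intro hB
      exact (subset_singleton_iff.1 (h.2.1 B hB)).resolve_left (h.1 B hB).ne_empty
    · rintro rfl
      obtain ⟨B, hB, haB⟩ := h.exists_mem (mem_singleton_self a)
      rwa [← (subset_singleton_iff.1 (h.2.1 B hB)).resolve_left (h.1 B hB).ne_empty]
  · rintro rfl
    refine ⟨isPartitionOn_of ?_ ?_ ?_ ?_, ?_⟩
    · simp
    · simp
    · simp
    · intro B hB C hC _ _ _
      rw [mem_singleton.1 hB, mem_singleton.1 hC]
    · intro B hB C hC hne
      exact absurd ((mem_singleton.1 hB).trans (mem_singleton.1 hC).symm) hne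

theorem sum_ncPartitions_filter_singleton_mem (w : ℕ → R) (j : ℕ) {a e : ℕ} (hae : a < e) :
    ∑ ρ ∈ ncPartitions (Ico a e) with {a} ∈ ρ,
        ∏ B ∈ ρ, w (if a ∈ B then B.card + j else B.card)
      = w (j + 1) * ncSum w 0 0 (Ico (a + 1) e) := by
  have hS : Ico a e = {a} ∪ Ico (a + 1) e := by
    ext x; simp only [mem_Ico, mem_union, mem_singleton]; omega
  have h := sum_ncPartitions_union (L := {a}) (T := Ico (a + 1) e) (by simp)
    (by simp only [mem_singleton]; intros; omega) (by simp only [mem_singleton]; intros; omega)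
    (fun B => w (if a ∈ B then B.card + j else B.card)) (fun _ => True) (by simp)
  rw [ncPartitions_singleton, sum_singleton, prod_singleton, filter_true, ← ncSum,
    ncSum_of_notMem _ _ (by simp), ← ncSum_zero w 0] at h
  rw [if_pos (mem_singleton_self a), card_singleton, add_comm 1, ← hS] at h
  rw [← h]
  refine sum_congr (filter_congr fun ρ hρ => ?_) fun _ _ => rfl
  obtain ⟨hρ, -⟩ := mem_ncPartitions.1 hρ
  rw [and_true]
  constructor
  · intro ha B hB
    by_cases h : a ∈ B
    · exact Or.inl (hρ.eq_of_mem hB ha h (mem_singleton_self a)).subset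
    · refine Or.inr fun x hx => ?_
      have h1 := mem_Ico.1 (hρ.2.1 B hB hx)
      have h2 : x ≠ a := fun h' => h (h' ▸ hx)
      exact mem_Ico.2 (by omega)
  · intro h
    obtain ⟨B, hB, haB⟩ := hρ.exists_mem (mem_Ico.2 ⟨le_rfl, hae⟩)
    rcases h B hB with h | h
    · rwa [← (subset_singleton_iff.1 h).resolve_left (hρ.1 B hB).ne_empty]
    · exact absurd (mem_Ico.1 (h haB)).1 (by omega)

theorem sum_ncPartitions_filter_second (w : ℕ → R) (j : ℕ) {a b e : ℕ} (hab : a < b)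
    (hbe : b < e) :
    ∑ ρ ∈ ncPartitions (Ico a e) with (∃ B ∈ ρ, a ∈ B ∧ b ∈ B ∧ ∀ c ∈ B, c ≠ a → b ≤ c),
        ∏ B ∈ ρ, w (if a ∈ B then B.card + j else B.card)
      = ncSum w 0 0 (Ico (a + 1) b) * ncSum w (j + 1) b (Ico b e) := by
  have hS : Ico a e = Ico (a + 1) b ∪ insert a (Ico b e) := by
    ext x; simp only [mem_Ico, mem_union, mem_insert]; omega
  have haL : a ∉ Ico (a + 1) b := by simp
  have h := sum_ncPartitions_union (L := Ico (a + 1) b) (T := insert a (Ico b e))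
    (Finset.disjoint_left.2 fun x hx hx' => by
      simp only [mem_insert, mem_Ico] at hx hx'; omega)
    (by simp only [mem_insert, mem_Ico]; intros; omega)
    (by simp only [mem_insert, mem_Ico]; intros; omega)
    (fun B => w (if a ∈ B then B.card + j else B.card)) (fun ρ => ∃ B ∈ ρ, a ∈ B ∧ b ∈ B) (by
      intro σ hσ τ _
      constructor
      · rintro ⟨B, hB, haB, hbB⟩
        rcases mem_union.1 hB with hB | hB
        · exact absurd (mem_powerset.1 (hσ hB) haB) haL
        · exact ⟨B, hB, haB, hbB⟩
      · rintro ⟨B, hB, h⟩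
        exact ⟨B, mem_union_right _ hB, h⟩)
  rw [sum_ncPartitions_insert w j hab (by simp [hbe]) (by simp +contextual), ← ncSum,
    ncSum_of_notMem _ _ haL, ← ncSum_zero w 0, ← hS] at h
  rw [← h]
  refine sum_congr (filter_congr fun ρ hρ => ?_) fun _ _ => rfl
  obtain ⟨hρ, hρ'⟩ := mem_ncPartitions.1 hρ
  constructor
  · rintro ⟨A, hA, haA, hbA, hmin⟩
    refine ⟨fun B hB => ?_, A, hA, haA, hbA⟩
    by_cases hBA : B = A
    · refine Or.inr fun x hx => ?_
      subst hBA
      by_cases hxa : x = a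
      · simp [hxa]
      · exact mem_insert_of_mem (mem_Ico.2 ⟨hmin x hx hxa, (mem_Ico.1 (hρ.2.1 B hB hx)).2⟩)
    · by_contra! hcon
      obtain ⟨h1, h2⟩ := hcon
      obtain ⟨y, hy, hyL⟩ := not_subset.1 h1
      obtain ⟨x, hx, hxT⟩ := not_subset.1 h2
      have h3 := mem_Ico.1 (hρ.2.1 B hB hx)
      have h4 := mem_Ico.1 (hρ.2.1 B hB hy)
      simp only [mem_insert, mem_Ico] at hyL hxT
      have h5 : y ≠ a := fun h => hBA (hρ.eq_of_mem hB hA hy (h ▸ haA))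
      have h6 : y ≠ b := fun h => hBA (hρ.eq_of_mem hB hA hy (h ▸ hbA))
      exact hρ' A hA B hB (fun h => hBA h.symm) ⟨a, b, x, y, haA, hbA, hx, hy, by omega,
        by omega, by omega⟩
  · rintro ⟨h, A, hA, haA, hbA⟩
    refine ⟨A, hA, haA, hbA, fun c hc hca => ?_⟩
    have hAT := (h A hA).resolve_left fun h => haL (h haA)
    have := (mem_insert.1 (hAT hc)).resolve_left hca
    exact (mem_Ico.1 this).1

/-- The decomposition of the sum over non-crossing partitions of an interval according to the
second smallest element of the block of the smallest element. -/
theorem ncSum_Ico_eq (w : ℕ → R) (j : ℕ) {a e : ℕ} (hae : a < e) :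
    ncSum w j a (Ico a e) = w (j + 1) * ncSum w 0 0 (Ico (a + 1) e)
      + ∑ b ∈ Ico (a + 1) e, ncSum w 0 0 (Ico (a + 1) b) * ncSum w (j + 1) b (Ico b e) := by
  rw [← sum_ncPartitions_filter_singleton_mem w j hae,
    sum_congr rfl fun b hb => (sum_ncPartitions_filter_second w j (a := a) (b := b) (e := e)
      (by have := mem_Ico.1 hb; omega) (mem_Ico.1 hb).2).symm]
  simp only [sum_filter]
  rw [sum_comm, ← sum_add_distrib, ncSum]
  refine sum_congr rfl fun ρ hρ => ?_
  obtain ⟨hρ, -⟩ := mem_ncPartitions.1 hρ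
  obtain ⟨A, hA, haA⟩ := hρ.exists_mem (mem_Ico.2 ⟨le_rfl, hae⟩)
  have hiff : ∀ b, (∃ B ∈ ρ, a ∈ B ∧ b ∈ B ∧ ∀ c ∈ B, c ≠ a → b ≤ c)
      ↔ (b ∈ A ∧ ∀ c ∈ A, c ≠ a → b ≤ c) := by
    intro b
    constructor
    · rintro ⟨B, hB, haB, h⟩
      rwa [hρ.eq_of_mem hA hB haA haB]
    · exact fun h => ⟨A, hA, haA, h⟩
  simp only [hiff]
  by_cases h : A = {a}
  · subst h
    rw [if_pos hA, sum_eq_zero, add_zero]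
    intro b hb
    refine if_neg fun h => ?_
    have := mem_Ico.1 hb
    have := mem_singleton.1 h.1
    omega
  · have hne : {a} ∉ ρ := fun h' => h (hρ.eq_of_mem hA h' haA (mem_singleton_self a))
    have hA' : (A.erase a).Nonempty := by
      rw [nonempty_iff_ne_empty]
      intro h0
      exact h (by rw [← insert_erase haA, h0]; rfl)
    have hmem := mem_erase.1 ((A.erase a).min'_mem hA')
    have hIco := mem_Ico.1 (hρ.2.1 A hA hmem.2)
    have hmin : ∀ c ∈ A, c ≠ a → (A.erase a).min' hA' ≤ c := fun c hc hca =>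
      (A.erase a).min'_le c (mem_erase.2 ⟨hca, hc⟩)
    rw [if_neg hne, zero_add, sum_eq_single ((A.erase a).min' hA')]
    · rw [if_pos ⟨hmem.2, hmin⟩]
    · intro b hb hb'
      refine if_neg fun h => hb' (le_antisymm (h.2 _ hmem.2 hmem.1) (hmin b h.1 ?_))
      have := mem_Ico.1 hb
      omega
    · intro h0
      exact absurd (mem_Ico.2 ⟨by omega, hIco.2⟩) h0

theorem ncPartitions_empty : ncPartitions ∅ = {∅} := by
  ext ρ
  rw [mem_ncPartitions, mem_singleton]
  constructor
  · rintro ⟨h, -⟩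
    refine eq_empty_of_forall_notMem fun B hB => ?_
    obtain ⟨x, hx⟩ := h.1 B hB
    exact absurd (h.2.1 B hB hx) (notMem_empty x)
  · rintro rfl
    exact ⟨isPartitionOn_of (by simp) (by simp) (by simp) (by simp), fun B hB => by simp at hB⟩

theorem mk_ncSum_eq (w : ℕ → R) (j : ℕ) :
    (PowerSeries.mk fun n => ncSum w j 0 (Ico 0 (n + 1)))
      = PowerSeries.C (w (j + 1)) * (PowerSeries.mk fun n => ncSum w 0 0 (Ico 0 n))
        + PowerSeries.X * ((PowerSeries.mk fun n => ncSum w 0 0 (Ico 0 n))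
          * PowerSeries.mk fun n => ncSum w (j + 1) 0 (Ico 0 (n + 1))) := by
  have hshift : ∀ a n, ncSum w 0 0 (Ico a (a + n)) = ncSum w 0 0 (Ico 0 n) := by
    intro a n
    rw [← ncSum_Ico w 0 a n, ncSum_zero, ncSum_zero]
  ext n
  rw [PowerSeries.coeff_mk, map_add, PowerSeries.coeff_C_mul, PowerSeries.coeff_mk,
    ncSum_Ico_eq w j (show 0 < n + 1 by omega), zero_add, add_comm n 1, hshift 1 n]
  congr 1
  rcases n with _ | n
  · simp
  · rw [PowerSeries.coeff_succ_X_mul, PowerSeries.coeff_mul,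
      Finset.Nat.sum_antidiagonal_eq_sum_range_succ_mk, sum_Ico_eq_sum_range,
      show 1 + (n + 1) - 1 = n.succ by omega]
    refine sum_congr rfl fun i hi => ?_
    have hi := mem_range.1 hi
    rw [PowerSeries.coeff_mk, PowerSeries.coeff_mk, hshift 1 i,
      show 1 + (n + 1) = (1 + i) + (n - i + 1) by omega, ncSum_Ico]

end NCSum

/-- Weighting each block by an additional indeterminate counts the blocks of the partitions. -/
theorem ncSum_polynomial_eval (c : ℕ → ℝ) (S : Finset ℕ) :
    (ncSum (fun n => Polynomial.C (c n) * Polynomial.X) 0 0 S).eval 1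
        = ∑ ρ ∈ ncPartitions S, ∏ B ∈ ρ, c B.card
      ∧ (ncSum (fun n => Polynomial.C (c n) * Polynomial.X) 0 0 S).derivative.eval 1
        = ∑ ρ ∈ ncPartitions S, (ρ.card : ℝ) * ∏ B ∈ ρ, c B.card := by
  have h : ncSum (fun n => Polynomial.C (c n) * Polynomial.X) 0 0 S
      = ∑ ρ ∈ ncPartitions S, Polynomial.C (∏ B ∈ ρ, c B.card) * Polynomial.X ^ ρ.card := by
    rw [ncSum_zero]
    refine sum_congr rfl fun ρ _ => ?_
    rw [prod_mul_distrib, prod_const, map_prod]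
  rw [h, Polynomial.derivative_sum, Polynomial.eval_finsetSum, Polynomial.eval_finsetSum]
  refine ⟨sum_congr rfl fun ρ _ => ?_, sum_congr rfl fun ρ _ => ?_⟩
  · rw [Polynomial.eval_mul, Polynomial.eval_C, Polynomial.eval_pow, Polynomial.eval_X, one_pow,
      mul_one]
  · rw [Polynomial.derivative_C_mul_X_pow, Polynomial.eval_mul, Polynomial.eval_C,
      Polynomial.eval_pow, Polynomial.eval_X, one_pow, mul_one, mul_comm]

/-- The differential equation satisfied by a family of formal power series given recursively,
where `Q` and `q` are the derivatives of `M` and `v` with respect to a scaling of `c`. -/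
theorem eq_of_forall_eq_C_mul_add {c : ℕ → ℝ} {M Q : PowerSeries ℝ} {v q : ℕ → PowerSeries ℝ}
    (hv : ∀ j, v j = PowerSeries.C (c (j + 1)) * M + PowerSeries.X * (M * v (j + 1)))
    (hq : ∀ j, q j = PowerSeries.C (c (j + 1)) * (M + Q)
      + PowerSeries.X * (Q * v (j + 1) + M * q (j + 1)))
    (hM : M = 1 + PowerSeries.X * v 0) (hQ : Q = PowerSeries.X * q 0) :
    PowerSeries.X * PowerSeries.derivative ℝ M
      = M * (PowerSeries.X * PowerSeries.derivative ℝ M + M - 1 - Q) := by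
  set D : PowerSeries ℝ → PowerSeries ℝ := fun f => PowerSeries.X * PowerSeries.derivative ℝ f
    with hD
  have hDv : ∀ j, D (v j) = PowerSeries.C (c (j + 1)) * D M
      + PowerSeries.X * (M * v (j + 1) + D M * v (j + 1) + M * D (v (j + 1))) := by
    intro j
    have : PowerSeries.derivative ℝ (v j) = PowerSeries.derivative ℝ
      (PowerSeries.C (c (j + 1)) * M + PowerSeries.X * (M * v (j + 1))) := congrArg _ (hv j)
    simp only [hD]
    rw [this]
    simp only [map_add, Derivation.leibniz, PowerSeries.derivative_C, PowerSeries.derivative_X,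
      smul_eq_mul]
    ring
  set E : ℕ → PowerSeries ℝ := fun j => (q j - v j) * (D M + M) - (D (v j) + v j) * Q with hE
  have hErec : ∀ j, E j = PowerSeries.X * M * E (j + 1) := by
    intro j
    simp only [hE]
    rw [hDv j, hq j, hv j]
    ring
  have hdvd : ∀ n j, PowerSeries.X ^ n ∣ E j := by
    intro n
    induction n with
    | zero => intro j; simp
    | succ n ih =>
      intro j
      rw [hErec j, pow_succ', mul_assoc]
      exact mul_dvd_mul_left _ (dvd_mul_of_dvd_right (ih _) _)
  have hE0 : E 0 = 0 := by
    ext n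
    exact (PowerSeries.X_pow_dvd_iff.1 (hdvd (n + 1) 0)) n n.lt_succ_self
  have hDM : D M = PowerSeries.X * (v 0 + D (v 0)) := by
    have : PowerSeries.derivative ℝ M = PowerSeries.derivative ℝ (1 + PowerSeries.X * v 0) :=
      congrArg _ hM
    simp only [hD]
    rw [this]
    simp only [map_add, Derivation.leibniz, Derivation.map_one_eq_zero, PowerSeries.derivative_X,
      smul_eq_mul]
    ring
  have h1 : PowerSeries.X * E 0 = 0 := by rw [hE0, mul_zero]
  simp only [hE] at h1
  change D M = M * (D M + M - 1 - Q)
  linear_combination h1 + (D M + M) * hQ - (D M + M) * hM - Q * hDM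

/-- The recursion relating the moments `M_k` and the sums `∑ (k + 1 - |ρ|) c_ρ` over
non-crossing partitions. -/
theorem ncFinset_sum_recursion (c : ℕ → ℝ) (k : ℕ) :
    ((k : ℝ) + 1) * ∑ ρ ∈ NCFinset (k + 1), ∏ B ∈ ρ, c B.card
      = ∑ p ∈ antidiagonal k,
          (∑ ρ ∈ NCFinset (p.1 + 1), (((p.1 + 1 : ℕ) : ℝ) + 1 - ρ.card) * ∏ B ∈ ρ, c B.card)
            * ∑ ρ ∈ NCFinset p.2, ∏ B ∈ ρ, c B.card := by
  set w : ℕ → Polynomial ℝ := fun n => Polynomial.C (c n) * Polynomial.X with hw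
  set μ : ℕ → Polynomial ℝ := fun n => ncSum w 0 0 (Ico 0 n) with hμ
  have hshift : ∀ n, ncSum w 0 0 (Icc 1 n) = μ n := by
    intro n
    change _ = ncSum w 0 0 (Ico 0 n)
    rw [← ncSum_Ico w 0 1 n, ncSum_zero, ncSum_zero]
    congr 2
    ext x
    simp only [mem_Icc, mem_Ico]
    omega
  have hM : ∀ n, ∑ ρ ∈ NCFinset n, ∏ B ∈ ρ, c B.card = (μ n).eval 1 := fun n => by
    rw [← hshift n, (ncSum_polynomial_eval c (Icc 1 n)).1]
    rfl
  have hQ : ∀ n, ∑ ρ ∈ NCFinset n, (ρ.card : ℝ) * ∏ B ∈ ρ, c B.card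
      = (μ n).derivative.eval 1 := fun n => by
    rw [← hshift n, (ncSum_polynomial_eval c (Icc 1 n)).2]
    rfl
  set ν : ℕ → ℕ → Polynomial ℝ := fun j n => ncSum w j 0 (Ico 0 (n + 1)) with hν
  have hrec : ∀ j n, ν j n = w (j + 1) * μ n
      + PowerSeries.coeff n (PowerSeries.X * (PowerSeries.mk μ * PowerSeries.mk (ν (j + 1)))) := by
    intro j n
    have := congrArg (PowerSeries.coeff n) (mk_ncSum_eq w j)
    rwa [PowerSeries.coeff_mk, map_add, PowerSeries.coeff_C_mul, PowerSeries.coeff_mk] at this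
  have hμν : ∀ n, μ (n + 1) = ν 0 n := fun n => rfl
  have hμ0 : μ 0 = 1 := by simp [hμ, ncSum, ncPartitions_empty]
  have key := eq_of_forall_eq_C_mul_add (c := c)
    (M := PowerSeries.mk fun n => (μ n).eval 1)
    (Q := PowerSeries.mk fun n => (μ n).derivative.eval 1)
    (v := fun j => PowerSeries.mk fun n => (ν j n).eval 1)
    (q := fun j => PowerSeries.mk fun n => (ν j n).derivative.eval 1) ?_ ?_ ?_ ?_
  · have h := congrArg (PowerSeries.coeff (k + 1)) key
    rw [PowerSeries.coeff_succ_X_mul, PowerSeries.coeff_derivative, PowerSeries.coeff_mk,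
      mul_comm, ← hM, mul_comm (PowerSeries.mk _), PowerSeries.coeff_mul,
      Finset.Nat.sum_antidiagonal_succ] at h
    have h0 : PowerSeries.coeff 0 (PowerSeries.X * PowerSeries.derivative ℝ
        (PowerSeries.mk fun n => (μ n).eval 1) + (PowerSeries.mk fun n => (μ n).eval 1) - 1
        - PowerSeries.mk fun n => (μ n).derivative.eval 1) = 0 := by
      simp [hμ0]
    rw [h0, zero_mul, zero_add] at h
    rw [h]
    refine sum_congr rfl fun p _ => ?_
    rw [PowerSeries.coeff_mk, hM p.2]
    congr 1
    simp only [map_sub, map_add, PowerSeries.coeff_succ_X_mul, PowerSeries.coeff_derivative,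
      PowerSeries.coeff_mk, PowerSeries.coeff_one, if_neg (Nat.succ_ne_zero _)]
    rw [← hM, ← hQ]
    simp only [sub_mul, add_mul, sum_sub_distrib, sum_add_distrib, ← mul_sum]
    push_cast
    ring
  · intro j
    ext n
    have := congrArg (Polynomial.eval 1) (hrec j n)
    rw [PowerSeries.coeff_mk, this, map_add, PowerSeries.coeff_C_mul, PowerSeries.coeff_mk]
    rcases n with _ | n
    · simp [hw]
    · simp only [PowerSeries.coeff_succ_X_mul]
      simp [hw, PowerSeries.coeff_mul, Polynomial.eval_finsetSum]
  · intro j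
    ext n
    have := congrArg (fun f => f.derivative.eval 1) (hrec j n)
    rw [PowerSeries.coeff_mk, this, Polynomial.derivative_add, map_add, PowerSeries.coeff_C_mul,
      map_add,
      PowerSeries.coeff_mk, PowerSeries.coeff_mk]
    rcases n with _ | n
    · simp [hw]
      ring
    · simp only [PowerSeries.coeff_succ_X_mul]
      simp [hw, PowerSeries.coeff_mul, Polynomial.eval_finsetSum, sum_add_distrib]
      ring
  · ext n
    rcases n with _ | n
    · simp [hμ0]
    · simp [PowerSeries.coeff_succ_X_mul, PowerSeries.coeff_one, hμν]
  · ext n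
    rcases n with _ | n
    · simp [hμ0]
    · simp [PowerSeries.coeff_succ_X_mul, hμν]

/-- Two sequences of integrable random variables whose expectations differ by `O(1 / N)`, where
`N = n + 1`. -/
def MeanClose {Ω : Type*} [MeasurableSpace Ω] (P : Measure Ω) (F G : ℕ → Ω → ℝ) : Prop :=
  (∀ n, Integrable (F n) P) ∧ (∀ n, Integrable (G n) P) ∧
    ∃ C : ℝ, ∀ n : ℕ, |(∫ ω, F n ω ∂P) - ∫ ω, G n ω ∂P| ≤ C / (n + 1)

namespace MeanClose

variable {Ω : Type*} [MeasurableSpace Ω] {P : Measure Ω}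

theorem const_mul {F G : ℕ → Ω → ℝ} (h : MeanClose P F G) (c : ℝ) :
    MeanClose P (fun n ω => c * F n ω) (fun n ω => c * G n ω) := by
  obtain ⟨hF, hG, C, hC⟩ := h
  refine ⟨fun n => (hF n).const_mul c, fun n => (hG n).const_mul c, |c| * C, fun n => ?_⟩
  rw [integral_const_mul, integral_const_mul, ← mul_sub, abs_mul, mul_div_assoc]
  exact mul_le_mul_of_nonneg_left (hC n) (abs_nonneg c)

theorem sub {F G F' G' : ℕ → Ω → ℝ} (h : MeanClose P F G) (h' : MeanClose P F' G') :
    MeanClose P (fun n ω => F n ω - F' n ω) (fun n ω => G n ω - G' n ω) := by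
  obtain ⟨hF, hG, C, hC⟩ := h
  obtain ⟨hF', hG', C', hC'⟩ := h'
  refine ⟨fun n => (hF n).sub (hF' n), fun n => (hG n).sub (hG' n), C + C', fun n => ?_⟩
  rw [integral_sub (hF n) (hF' n), integral_sub (hG n) (hG' n), sub_sub_sub_comm, add_div]
  exact (abs_sub _ _).trans (add_le_add (hC n) (hC' n))

theorem sum {ι : Type*} (s : Finset ι) {F G : ι → ℕ → Ω → ℝ}
    (h : ∀ i ∈ s, MeanClose P (F i) (G i)) :
    MeanClose P (fun n ω => ∑ i ∈ s, F i n ω) (fun n ω => ∑ i ∈ s, G i n ω) := by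
  classical
  choose! C hC using fun i hi => (h i hi).2.2
  refine ⟨fun n => integrable_finsetSum _ fun i hi => (h i hi).1 n,
    fun n => integrable_finsetSum _ fun i hi => (h i hi).2.1 n, ∑ i ∈ s, C i, fun n => ?_⟩
  rw [integral_finsetSum _ fun i hi => (h i hi).1 n,
    integral_finsetSum _ fun i hi => (h i hi).2.1 n, ← sum_sub_distrib, sum_div]
  exact (abs_sum_le_sum_abs _ _).trans (sum_le_sum fun i hi => hC i hi n)

/-- If the products of the `x k` and of the `y k` have close means, then so do quantities obtained
from them through the same recursion. -/
theorem of_recursion {x y S T : ℕ → ℕ → Ω → ℝ}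
    (h : ∀ J : List ℕ, MeanClose P (fun n ω => (J.map fun j => x n j ω).prod)
      (fun n ω => (J.map fun j => y n j ω).prod))
    (hx : ∀ n ω, x n 0 ω = 1) (hy : ∀ n ω, y n 0 ω = 1)
    (hS : ∀ (n k : ℕ) (ω : Ω), ((k : ℝ) + 1) * x n (k + 1) ω
      = ∑ p ∈ antidiagonal k, S n (p.1 + 1) ω * x n p.2 ω)
    (hT : ∀ (n k : ℕ) (ω : Ω), ((k : ℝ) + 1) * y n (k + 1) ω
      = ∑ p ∈ antidiagonal k, T n (p.1 + 1) ω * y n p.2 ω) (k : ℕ) :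
    ∀ J : List ℕ, MeanClose P (fun n ω => S n (k + 1) ω * (J.map fun j => x n j ω).prod)
      (fun n ω => T n (k + 1) ω * (J.map fun j => y n j ω).prod) := by
  induction k using Nat.strong_induction_on with
  | _ k ih =>
    intro J
    have key : ∀ {x S : ℕ → ℕ → Ω → ℝ}, (∀ n ω, x n 0 ω = 1) →
        (∀ (n k : ℕ) (ω : Ω), ((k : ℝ) + 1) * x n (k + 1) ω
          = ∑ p ∈ antidiagonal k, S n (p.1 + 1) ω * x n p.2 ω) →
        (fun n ω => S n (k + 1) ω * (J.map fun j => x n j ω).prod)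
          = fun n ω => ((k : ℝ) + 1) * (((k + 1) :: J).map fun j => x n j ω).prod
            - ∑ p ∈ (antidiagonal k).erase (k, 0),
              S n (p.1 + 1) ω * ((p.2 :: J).map fun j => x n j ω).prod := by
      intro x S hx hS
      funext n ω
      have h1 := hS n k ω
      rw [← add_sum_erase _ _ (mem_antidiagonal.2 (add_zero k) : (k, 0) ∈ antidiagonal k)] at h1
      simp only [hx, mul_one] at h1
      simp only [List.map_cons, List.prod_cons, ← mul_assoc]
      rw [← sum_mul, h1]
      ring
    rw [key hx hS, key hy hT]
    refine ((h _).const_mul _).sub (sum _ fun p hp => ?_)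
    obtain ⟨hne, hp⟩ := mem_erase.1 hp
    have hp := mem_antidiagonal.1 hp
    refine ih p.1 (lt_of_le_of_ne (by omega) fun h0 => hne (Prod.ext h0 ?_)) _
    simp only
    omega

end MeanClose

/-- The products of the diagonal entries of powers of unitarily invariant matrices have means
close to those of the products of the normalized traces. -/
theorem meanClose_prod_corner {Ω : Type} [MeasurableSpace Ω] {P : Measure Ω}
    [IsProbabilityMeasure P] {U : (n : ℕ) → Ω → Matrix (Fin (n + 1)) (Fin (n + 1)) ℂ}
    {D : (n : ℕ) → Ω → (Fin (n + 1) → ℝ)} (hU : ∀ n, Measurable (U n))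
    (hD : ∀ n, Measurable (D n))
    (hUu : ∀ n ω, U n ω ∈ Matrix.unitaryGroup (Fin (n + 1)) ℂ)
    (hH : ∀ n, (Measure.map
      (fun ω => (⟨U n ω, hUu n ω⟩ : Matrix.unitaryGroup (Fin (n + 1)) ℂ)) P).IsHaarMeasure)
    (hind : ∀ n, IndepFun (U n) (D n) P)
    (hint : ∀ n k : ℕ, Integrable (fun ω => 1 / (n + 1 : ℝ) * ∑ p, D n ω p ^ k) P)
    (hsup : ∀ k, Even k → ∃ C : ℝ, ∀ n : ℕ,
      (∫ ω, 1 / (n + 1 : ℝ) * ∑ p, D n ω p ^ k ∂P) ≤ C) (J : List ℕ) :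
    MeanClose P (fun n ω => (J.map fun j => ∑ p, ‖U n ω (Fin.last n) p‖ ^ 2 * D n ω p ^ j).prod)
      (fun n ω => (J.map fun j => 1 / (n + 1 : ℝ) * ∑ p, D n ω p ^ j).prod) := by
  simp only [← Fin.prod_univ_fun_getElem]
  have h := fun n => abs_integral_prod_sub_le (hU n) (hD n) (hUu n) (hH n) (hind n) (hint n)
    (Fin.last n) (fun l : Fin J.length => J[l.1])
  obtain ⟨K, hK, hKE⟩ := exists_sum_abs_entries_sub_le J.length
  obtain ⟨C, hC⟩ := hsup _ (even_two_mul (∑ l : Fin J.length, J[l.1]))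
  refine ⟨fun n => (h n).1, fun n => (h n).2.1, K * (1 + J.length * |C|), fun n => ?_⟩
  refine (h n).2.2.trans ?_
  have h1 := hKE (hU n) (hUu n) (hH n) (Fin.last n)
  rw [Fintype.card_fin] at h1
  rw [mul_div_right_comm, Fintype.card_fin]
  push_cast at h1 ⊢
  exact mul_le_mul h1 (by gcongr; exact (hC n).trans (le_abs_self C))
    (add_nonneg zero_le_one (mul_nonneg (Nat.cast_nonneg _) (integral_nonneg fun ω =>
      mul_nonneg (by positivity) (sum_nonneg fun p _ => (even_two_mul _).pow_nonneg _))))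
    (by positivity)

/-- For each `N = n+1 ≥ 1`, let `X_N = U_N D_N U_N^*` where `U_N` is a
Haar unitary random matrix and `D_N` an independent random real diagonal matrix; let
`lam n` be the ordered eigenvalues of `X_N`, `lamt n` the ordered eigenvalues of the
principal submatrix obtained by deleting the last row and column, `Mm n k` the `k`-th
moment of the empirical eigenvalue distribution `m_N`, `fc n` the free cumulants of
`m_N`, `Mκ n k = Σ λ_i^k − Σ λ̃_j^k` the moments of the Rayleigh measure `κ_N`, and
`Mτ n k = Σ_{ρ ∈ NC(k)} (k+1−|ρ|) fc_ρ(m_N)`.  Assume `sup_N E[M_k(m_N)] < ∞` for all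
even `k`.  Then for every `k ≥ 1`, `E[M_k(κ_N)] = E[M_k(τ_N)] + O(1/N)`. -/
theorem statement4
    {Ω : Type} [MeasurableSpace Ω] (Pr : Measure Ω) [IsProbabilityMeasure Pr]
    (U : (n : ℕ) → Ω → Matrix (Fin (n + 1)) (Fin (n + 1)) ℂ)
    (D : (n : ℕ) → Ω → (Fin (n + 1) → ℝ))
    (hUmeas : ∀ n, Measurable (U n))
    (hDmeas : ∀ n, Measurable (D n))
    (hUuni : ∀ n ω, U n ω ∈ Matrix.unitaryGroup (Fin (n + 1)) ℂ)
    -- `U_N` is Haar distributed on the unitary group: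
    (hHaar : ∀ n, (Measure.map
      (fun ω => (⟨U n ω, hUuni n ω⟩ : Matrix.unitaryGroup (Fin (n + 1)) ℂ)) Pr).IsHaarMeasure)
    -- `D_N` is independent of `U_N`:
    (hindep : ∀ n, IndepFun (U n) (D n) Pr)
    (X : (n : ℕ) → Ω → Matrix (Fin (n + 1)) (Fin (n + 1)) ℂ)
    (hX : ∀ n ω, X n ω = U n ω * Matrix.diagonal (fun i => (D n ω i : ℂ)) * star (U n ω))
    -- the ordered eigenvalues `λ_1 ≤ ⋯ ≤ λ_N` of `X_N`:
    (lam : (n : ℕ) → Ω → (Fin (n + 1) → ℝ))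
    (hlam_mono : ∀ n ω, Monotone (lam n ω))
    (hlam_eig : ∀ n ω, ∃ V ∈ Matrix.unitaryGroup (Fin (n + 1)) ℂ,
      X n ω = V * Matrix.diagonal (fun i => (lam n ω i : ℂ)) * star V)
    -- the ordered eigenvalues `λ̃_1 ≤ ⋯ ≤ λ̃_{N−1}` of the principal submatrix:
    (lamt : (n : ℕ) → Ω → (Fin n → ℝ))
    (hlamt_mono : ∀ n ω, Monotone (lamt n ω))
    (hlamt_eig : ∀ n ω, ∃ V ∈ Matrix.unitaryGroup (Fin n) ℂ,
      (X n ω).submatrix Fin.castSucc Fin.castSucc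
        = V * Matrix.diagonal (fun j => (lamt n ω j : ℂ)) * star V)
    -- the moments of the empirical eigenvalue distribution `m_N`:
    (Mm : ℕ → ℕ → Ω → ℝ)
    (hMm : ∀ n k ω, Mm n k ω = (1 / (n + 1 : ℝ)) * ∑ i, lam n ω i ^ k)
    (hint : ∀ n k, Integrable (Mm n k) Pr)
    -- `sup_{N ≥ 1} E[M_k(m_N)] < ∞` for every even `k`:
    (hsup : ∀ k : ℕ, Even k → ∃ C : ℝ, ∀ n, (∫ ω, Mm n k ω ∂Pr) ≤ C)
    -- the free cumulants of `m_N`, characterized by the moment–cumulant formula: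
    (fc : ℕ → ℕ → Ω → ℝ)
    (hfc : ∀ n, ∀ k : ℕ, 1 ≤ k → ∀ ω,
      Mm n k ω = ∑ ρ ∈ NCFinset k, ∏ B ∈ ρ, fc n B.card ω)
    -- the moments of the Rayleigh measure `κ_N`:
    (Mκ : ℕ → ℕ → Ω → ℝ)
    (hMκ : ∀ n k ω, Mκ n k ω = (∑ i, lam n ω i ^ k) - ∑ j, lamt n ω j ^ k)
    -- `M_k(τ_N) = Σ_{ρ ∈ NC(k)} (k+1−|ρ|) fc_ρ(m_N)`:
    (Mτ : ℕ → ℕ → Ω → ℝ)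
    (hMτ : ∀ n k ω, Mτ n k ω
      = ∑ ρ ∈ NCFinset k, ((k : ℝ) + 1 - ρ.card) * ∏ B ∈ ρ, fc n B.card ω)
    (k : ℕ) (hk : 1 ≤ k) :
    ∃ C : ℝ, ∀ n : ℕ,
      |(∫ ω, Mκ n k ω ∂Pr) - ∫ ω, Mτ n k ω ∂Pr| ≤ C / (n + 1) := by
  have hdiag : ∀ n ω k, ∑ i, lam n ω i ^ k = ∑ p, D n ω p ^ k := by
    intro n ω k
    obtain ⟨V, hV, hXV⟩ := hlam_eig n ω
    have h := trace_unitary_conj_diagonal_pow hV (fun i => (lam n ω i : ℂ)) k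
    rw [← hXV, hX n ω, trace_unitary_conj_diagonal_pow (hUuni n ω)] at h
    exact_mod_cast h.symm
  have hMm' : ∀ (n k : ℕ) (ω : Ω), Mm n k ω = 1 / (n + 1 : ℝ) * ∑ p, D n ω p ^ k := fun n k ω => by
    rw [hMm, hdiag]
  have hMfun : ∀ n k : ℕ, Mm n k = fun ω => 1 / (n + 1 : ℝ) * ∑ p, D n ω p ^ k := fun n k =>
    funext (hMm' n k)
  have hclose := meanClose_prod_corner hUmeas hDmeas hUuni hHaar hindep
    (fun n k => hMfun n k ▸ hint n k) (fun k hk => by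
      obtain ⟨C, hC⟩ := hsup k hk
      exact ⟨C, fun n => by simpa only [hMm'] using hC n⟩)
  have hM0 : ∀ (n : ℕ) (ω : Ω), 1 / (n + 1 : ℝ) * ∑ p, D n ω p ^ 0 = 1 := by
    intro n ω
    have : (n : ℝ) + 1 ≠ 0 := by positivity
    simp [this]
  have hκ : ∀ (n k : ℕ) (ω : Ω), ((k : ℝ) + 1) * ∑ p, ‖U n ω (Fin.last n) p‖ ^ 2 * D n ω p ^ (k + 1)
      = ∑ q ∈ antidiagonal k, Mκ n (q.1 + 1) ω
        * ∑ p, ‖U n ω (Fin.last n) p‖ ^ 2 * D n ω p ^ q.2 := by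
    intro n k ω
    obtain ⟨W, hW, hXW⟩ := hlamt_eig n ω
    have h := corner_pow_recursion (hUuni n ω) (hX n ω) hW hXW k
    rw [hX n ω] at h
    simp only [unitary_conj_diagonal_pow_apply_self (hUuni n ω)] at h
    simp only [hMκ, hdiag]
    exact_mod_cast h
  have hτ : ∀ (n k : ℕ) (ω : Ω), ((k : ℝ) + 1) * (1 / (n + 1 : ℝ) * ∑ p, D n ω p ^ (k + 1))
      = ∑ q ∈ antidiagonal k, Mτ n (q.1 + 1) ω * (1 / (n + 1 : ℝ) * ∑ p, D n ω p ^ q.2) := by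
    intro n k ω
    have hNC : ∀ k, ∑ ρ ∈ NCFinset k, ∏ B ∈ ρ, fc n B.card ω
        = 1 / (n + 1 : ℝ) * ∑ p, D n ω p ^ k := by
      intro k
      rcases Nat.eq_zero_or_pos k with rfl | hk
      · have : NCFinset 0 = {∅} := ncPartitions_empty
        rw [hM0, this, sum_singleton, prod_empty]
      · rw [← hfc n k hk ω, hMm']
    have h := ncFinset_sum_recursion (fun m => fc n m ω) k
    simp only [hNC] at h
    simp only [hMτ]
    exact h
  obtain ⟨m, rfl⟩ : ∃ m, k = m + 1 := ⟨k - 1, by omega⟩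
  have h := (MeanClose.of_recursion
    (x := fun n j ω => ∑ p, ‖U n ω (Fin.last n) p‖ ^ 2 * D n ω p ^ j)
    (y := fun n j ω => 1 / (n + 1 : ℝ) * ∑ p, D n ω p ^ j) hclose
    (fun n ω => by simpa using sum_norm_sq_row_eq_one (hUuni n ω) (Fin.last n)) hM0 hκ hτ m
    []).2.2
  simpa only [List.map_nil, List.prod_nil, mul_one] using h
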